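/- arXiv:2404.15123 — 2 statements merged into one kernel-verified Lean document; each statement's English description precedes it below -/
import Mathlib

section
/- Let ψ: ℕ → [0,1/2], and for n ∈ ℕ let 𝒜_n := ⋃_{0 ≤ a ≤ n, gcd(a,n)=1} [a/n − ψ(n)/n, a/n + ψ(n)/n] ∩ [0,1]. For positive integers n ≠ m set D = D(n,m) := max(m·ψ(n), n·ψ(m))/gcd(n,m), and for 0 < ρ < 1/2 write F_ρ(x) = exp((log x)^{1/2−ρ}). Then for any 0 < ρ < 1/2, λ(𝒜_n ∩ 𝒜_m) ≤ λ(𝒜_n)·λ(𝒜_m)·(1 + O_ρ(F_ρ(D)^{−1})) · ∏_{p | nm/gcd(n,m)², p > F_ρ(D)} (1 + 1/(p−1)), with an implied constant depending only on ρ, where the product is over primes p dividing nm/gcd(n,m)² with p > F_ρ(D). -/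
open MeasureTheory

/-- `𝒜_n = ⋃_{0 ≤ a ≤ n, gcd(a,n)=1} [a/n - ψ(n)/n, a/n + ψ(n)/n] ∩ [0,1]`. -/
noncomputable def DSset (ψ : ℕ → ℝ) (n : ℕ) : Set ℝ :=
  (⋃ a ∈ {a : ℕ | a ≤ n ∧ Nat.Coprime a n},
    Set.Icc ((a : ℝ) / n - ψ n / n) ((a : ℝ) / n + ψ n / n)) ∩ Set.Icc 0 1

/-- `D(n,m) = max(m ψ(n), n ψ(m)) / gcd(n,m)`. -/
noncomputable def Dfun (ψ : ℕ → ℝ) (n m : ℕ) : ℝ :=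
  max ((m : ℝ) * ψ n) ((n : ℝ) * ψ m) / (Nat.gcd n m : ℝ)

/-- `F_ρ(x) = exp((log x)^{1/2-ρ})`. -/
noncomputable def Frho (ρ x : ℝ) : ℝ := Real.exp ((Real.log x) ^ ((1:ℝ)/2 - ρ))

/-- partial alternating sums of elementary symmetric functions -/
noncomputable def esy {ι : Type*} (P : Finset ι) (x : ι → ℝ) (j : ℕ) : ℝ :=
  ∑ S ∈ P.powersetCard j, ∏ p ∈ S, x p

lemma esy_zero {ι : Type*} (P : Finset ι) (x : ι → ℝ) : esy P x 0 = 1 := by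
  simp [esy]

lemma esy_insert {ι : Type*} [DecidableEq ι] (P : Finset ι) (x : ι → ℝ) (a : ι) (ha : a ∉ P) (j : ℕ) :
    esy (insert a P) x (j+1) = esy P x (j+1) + x a * esy P x j := by
  unfold esy
  rw [Finset.powersetCard_succ_insert ha, Finset.sum_union, Finset.sum_image, Finset.mul_sum]
  · congr 1
    apply Finset.sum_congr rfl
    intro S hS
    rw [Finset.mem_powersetCard] at hS
    rw [Finset.prod_insert (fun h => ha (hS.1 h))]
  · intro S hS T hT h
    rw [Finset.mem_coe, Finset.mem_powersetCard] at hS hT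
    have h1 : a ∉ S := fun h => ha (hS.1 h)
    have h2 : a ∉ T := fun h => ha (hT.1 h)
    rw [← Finset.erase_insert h1, ← Finset.erase_insert h2]
    rw [h]
  · rw [Finset.disjoint_left]
    intro S hS hS'
    rw [Finset.mem_powersetCard] at hS
    rw [Finset.mem_image] at hS'
    obtain ⟨T, _, rfl⟩ := hS'
    exact ha (hS.1 (Finset.mem_insert_self _ _))

lemma esy_nonneg {ι : Type*} (P : Finset ι) (x : ι → ℝ) (hx : ∀ p ∈ P, 0 ≤ x p) (j : ℕ) :
    0 ≤ esy P x j := by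
  apply Finset.sum_nonneg
  intro S hS
  rw [Finset.mem_powersetCard] at hS
  exact Finset.prod_nonneg (fun p hp => hx p (hS.1 hp))

lemma altsum_insert {ι : Type*} [DecidableEq ι] (P : Finset ι) (x : ι → ℝ) (a : ι) (ha : a ∉ P) (k : ℕ) :
    ∑ j ∈ Finset.range (k+1), (-1:ℝ)^j * esy (insert a P) x j =
    ∑ j ∈ Finset.range (k+1), (-1:ℝ)^j * esy P x j
      - x a * ∑ j ∈ Finset.range k, (-1:ℝ)^j * esy P x j := by
  rw [Finset.sum_range_succ', Finset.sum_range_succ' _ k, esy_zero, esy_zero, Finset.mul_sum]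
  rw [add_sub_right_comm, ← Finset.sum_sub_distrib]
  congr 1
  apply Finset.sum_congr rfl
  intro j _
  rw [esy_insert P x a ha]; ring

lemma bonferroni {ι : Type*} [DecidableEq ι] (x : ι → ℝ) (P : Finset ι)
    (hx : ∀ p ∈ P, 0 ≤ x p ∧ x p ≤ 1) : ∀ (k : ℕ),
    0 ≤ (-1:ℝ)^k * (∏ p ∈ P, (1 - x p) - ∑ j ∈ Finset.range k, (-1:ℝ)^j * esy P x j) := by
  induction P using Finset.induction_on with
  | empty =>
    intro k
    cases k with
    | zero => simp
    | succ k =>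
      rw [Finset.sum_range_succ', esy_zero]
      have : ∑ j ∈ Finset.range k, (-1:ℝ)^(j+1) * esy ∅ x (j+1) = 0 := by
        apply Finset.sum_eq_zero
        intro j _
        have : esy ∅ x (j+1) = 0 := by
          unfold esy
          rw [Finset.powersetCard_eq_empty.2 (by simp)]; simp
        simp [this]
      rw [this]; simp
  | insert a P ha ih =>
    have ih := ih (fun p hp => hx p (Finset.mem_insert_of_mem hp))
    have hxa := hx a (Finset.mem_insert_self _ _)
    intro k
    cases k with
    | zero =>
      simp only [pow_zero, Finset.range_zero, Finset.sum_empty, sub_zero, one_mul]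
      exact Finset.prod_nonneg (fun p hp => by linarith [(hx p hp).2])
    | succ k =>
      rw [altsum_insert P x a ha, Finset.prod_insert ha]
      have h1 := ih (k+1)
      have h2 := mul_nonneg hxa.1 (ih k)
      rw [pow_succ] at h1 ⊢
      nlinarith

lemma esy_le {ι : Type*} [DecidableEq ι] (x : ι → ℝ) (P : Finset ι)
    (hx : ∀ p ∈ P, 0 ≤ x p) : ∀ (j : ℕ),
    esy P x j ≤ (∑ p ∈ P, x p)^j / (j.factorial : ℝ) := by
  induction P using Finset.induction_on with
  | empty =>
    intro j
    cases j with
    | zero => simp [esy]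
    | succ k => 
      unfold esy
      rw [Finset.powersetCard_eq_empty.2 (by simp)]; simp
  | insert a P ha ih =>
    have hP : ∀ p ∈ P, 0 ≤ x p := (fun p hp => hx p (Finset.mem_insert_of_mem hp))
    have ih := ih hP
    have hxa := hx a (Finset.mem_insert_self _ _)
    have hs : 0 ≤ ∑ p ∈ P, x p := Finset.sum_nonneg hP
    intro j
    cases j with
    | zero => simp [esy]
    | succ k =>
      rw [esy_insert P x a ha, Finset.sum_insert ha]
      set s := ∑ p ∈ P, x p
      have h1 := ih (k+1)
      have h2 := mul_le_mul_of_nonneg_left (ih k) hxa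
      refine (add_le_add h1 h2).trans ?_
      have h3 : s^(k+1) + (k+1) * s^k * x a ≤ (x a + s)^(k+1) := by
        have : ∀ k : ℕ, s^(k+1) + (k+1) * s^k * x a ≤ (x a + s)^(k+1) := by
          intro k
          induction k with
          | zero => simp; linarith
          | succ k ih =>
            rw [pow_succ (x a + s)]
            have := mul_le_mul_of_nonneg_right ih (add_nonneg hxa hs)
            refine le_trans ?_ this
            push_cast
            have : 0 ≤ (k+1) * s^k * x a * x a := by positivity
            ring_nf at this ⊢
            linarith
        exact this k
      rw [Nat.factorial_succ]
      push_cast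
      have hf : (0:ℝ) < k.factorial := by positivity
      rw [show x a * (s^k / (k.factorial:ℝ)) = (k+1) * s^k * x a / ((k+1) * k.factorial) by field_simp,
        ← add_div]
      gcongr

lemma esy_count {ι : Type*} (P : Finset ι) (k N : ℕ) (hN : P.card ≤ N) :
    ∑ j ∈ Finset.range (k+1), ((P.powersetCard j).card : ℝ) ≤ ((N:ℝ)+1)^k := by
  rw [add_pow]
  apply Finset.sum_le_sum
  intro j hj
  have hj' : j ≤ k := by simpa [Nat.lt_succ_iff] using hj
  rw [Finset.card_powersetCard]
  simp only [one_pow, mul_one]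
  have h1 : P.card.choose j ≤ N^j := (Nat.choose_le_choose j hN).trans (Nat.choose_le_pow N j)
  have h2 : 1 ≤ k.choose j := Nat.choose_pos hj'
  exact_mod_cast h1.trans (Nat.le_mul_of_pos_right _ h2)

lemma prod_lower' (Q : ℕ → Prop) [DecidablePred Q] (hQ : ∀ p, Q p → 2 ≤ p) (Z : ℕ) :
    1 / ((Z:ℝ)+1) ≤ ∏ p ∈ (Finset.range (Z+2)).filter Q, (1 - 1/(p:ℝ)) := by
  induction Z with
  | zero =>
    have : (Finset.range 2).filter Q = ∅ := by
      ext p; simp; intro h1 h; have := hQ _ h; omega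
    rw [this]; simp
  | succ Z ih =>
    rw [Finset.range_add_one, Finset.filter_insert]
    split_ifs with h
    · rw [Finset.prod_insert (by simp)]
      have : (0:ℝ) ≤ 1 - 1/((Z+1+1:ℕ):ℝ) := by
        rw [sub_nonneg, div_le_one (by positivity)]; exact_mod_cast (by omega)
      refine le_trans ?_ (mul_le_mul_of_nonneg_left ih this)
      push_cast
      apply le_of_eq
      field_simp
      ring
    · refine le_trans ?_ ih
      push_cast
      gcongr
      linarith

lemma prod_lower (Q : ℕ → Prop) [DecidablePred Q] (hQ : ∀ p, Q p → 2 ≤ p) (Z : ℕ) :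
    1 / ((Z:ℝ)+1) ≤ ∏ p ∈ (Finset.range (Z+1)).filter Q, (1 - 1/(p:ℝ)) := by
  cases Z with
  | zero =>
    have : (Finset.range 1).filter Q = ∅ := by
      ext p; simp; rintro rfl h; have := hQ _ h; omega
    rw [this]; simp
  | succ Z =>
    refine le_trans ?_ (prod_lower' Q hQ Z)
    push_cast
    gcongr
    linarith

lemma sum_upper (Q : ℕ → Prop) [DecidablePred Q] (hQ : ∀ p, Q p → 2 ≤ p) (Z : ℕ) :
    ∑ p ∈ (Finset.range (Z+1)).filter Q, 1/(p:ℝ) ≤ 1 + Real.log Z := by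
  have h := harmonic_le_one_add_log Z
  refine le_trans ?_ h
  rw [harmonic_eq_sum_Icc]
  push_cast
  simp only [one_div]
  apply Finset.sum_le_sum_of_subset_of_nonneg
  · intro p hp
    simp only [Finset.mem_filter, Finset.mem_range, Finset.mem_Icc] at hp ⊢
    have := hQ _ hp.2; omega
  · intros; positivity

/-- sums over intervals of periodic functions -/
lemma sum_Ico_zmod (q : ℕ) [NeZero q] (h : ZMod q → ℝ) (u : ℤ) :
    ∑ c ∈ Finset.Ico u (u + q), h (c : ZMod q) = ∑ x : ZMod q, h x := by
  have hq : 0 < q := Nat.pos_of_ne_zero (NeZero.ne q)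
  refine Finset.sum_bij (fun (c : ℤ) _ => (c : ZMod q)) ?_ ?_ ?_ ?_
  · intros; simp
  · intro a ha b hb hab
    rw [ZMod.intCast_eq_intCast_iff_dvd_sub] at hab
    simp only [Finset.mem_Ico] at ha hb
    have := Int.eq_zero_of_abs_lt_dvd hab (by rw [abs_lt]; constructor <;> linarith)
    linarith
  · intro x _
    refine ⟨u + ((x - u : ZMod q)).val, ?_, ?_⟩
    · have := ZMod.val_lt (x - (u : ZMod q))
      rw [Finset.mem_Ico]; omega
    · push_cast
      rw [ZMod.natCast_zmod_val]; ring
  · intros; rfl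

lemma sum_Ico_blocks (q : ℕ) [NeZero q] (h : ZMod q → ℝ) (u : ℤ) (j : ℕ) :
    ∑ c ∈ Finset.Ico u (u + (j * q : ℕ)), h (c : ZMod q) = j * ∑ x : ZMod q, h x := by
  induction j with
  | zero => simp
  | succ j ih =>
    rw [← Finset.Ico_union_Ico_eq_Ico (b := u + (j*q : ℕ)) (by push_cast; nlinarith)
      (by push_cast; nlinarith), Finset.sum_union (Finset.Ico_disjoint_Ico_consecutive _ _ _), ih]
    have : u + ((j+1)*q : ℕ) = (u + (j*q:ℕ)) + q := by push_cast; ring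
    rw [this, sum_Ico_zmod]; push_cast; ring

lemma sum_Ico_approx (q : ℕ) [NeZero q] (h : ZMod q → ℝ) (h0 : ∀ x, 0 ≤ h x) (h1 : ∑ x, h x = 1)
    (u : ℤ) (M : ℕ) :
    |∑ c ∈ Finset.Ico u (u + M), h (c : ZMod q) - M * (1/(q:ℝ))| ≤ 1 := by
  have hq : 0 < q := Nat.pos_of_ne_zero (NeZero.ne q)
  have hq' : (0:ℝ) < q := by exact_mod_cast hq
  have e1 := sum_Ico_blocks q h u (M/q)
  have e2 := sum_Ico_blocks q h u (M/q+1)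
  have hM := Nat.div_add_mod M q
  have hr := Nat.mod_lt M hq
  have i1 : M/q * q ≤ M := Nat.div_mul_le_self M q
  have i2 : M ≤ (M/q+1)*q := by rw [add_mul, mul_comm (M/q)]; omega
  rw [h1, mul_one] at e1 e2
  have l1 : ∑ c ∈ Finset.Ico u (u + (M/q*q : ℕ)), h (c : ZMod q) ≤ ∑ c ∈ Finset.Ico u (u + M), h (c : ZMod q) :=
    Finset.sum_le_sum_of_subset_of_nonneg (Finset.Ico_subset_Ico le_rfl (by
      have : ((M/q*q : ℕ):ℤ) ≤ M := by exact_mod_cast i1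
      linarith)) (fun _ _ _ => h0 _)
  have l2 : ∑ c ∈ Finset.Ico u (u + M), h (c : ZMod q) ≤ ∑ c ∈ Finset.Ico u (u + ((M/q+1)*q : ℕ)), h (c : ZMod q) :=
    Finset.sum_le_sum_of_subset_of_nonneg (Finset.Ico_subset_Ico le_rfl (by
      have : (M:ℤ) ≤ (((M/q+1)*q : ℕ):ℤ) := by exact_mod_cast i2
      linarith)) (fun _ _ _ => h0 _)
  rw [e1] at l1
  rw [e2] at l2
  have j1 : ((M/q:ℕ):ℝ) ≤ M * (1/(q:ℝ)) := by
    rw [mul_one_div, le_div_iff₀ hq']; exact_mod_cast i1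
  have j2 : (M:ℝ) * (1/(q:ℝ)) ≤ ((M/q:ℕ):ℝ) + 1 := by
    rw [mul_one_div, div_le_iff₀ hq']; exact_mod_cast i2
  push_cast at l2
  rw [abs_le]; constructor <;> linarith

lemma zmod_crt_sum (a b : ℕ) [NeZero a] [NeZero b] [NeZero (a*b)] (hab : Nat.Coprime a b)
    (f : ZMod a → ℝ) (g : ZMod b → ℝ) :
    ∃ h : ZMod (a*b) → ℝ, (∀ c : ℤ, h c = f c * g c) ∧ ∑ x, h x = (∑ x, f x) * ∑ x, g x := by
  refine ⟨fun x => f (ZMod.chineseRemainder hab x).1 * g (ZMod.chineseRemainder hab x).2, ?_, ?_⟩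
  · intro c; simp
  · have := (ZMod.chineseRemainder hab).toEquiv.sum_comp (fun y => f y.1 * g y.2)
    rw [Fintype.sum_prod_type, ← Finset.sum_mul_sum] at this
    exact this

lemma zmod_prod_sum (f : (p : ℕ) → ZMod p → ℝ) (S : Finset ℕ) (hS : ∀ p ∈ S, p.Prime) :
    ∃ h : ZMod (∏ p ∈ S, p) → ℝ, (∀ c : ℤ, h c = ∏ p ∈ S, f p c) ∧
      (∀ (u : ℤ) , ∑ c ∈ Finset.Ico u (u + (∏ p ∈ S, p : ℕ)), h c = ∏ p ∈ S, ∑ c ∈ Finset.Ico (0:ℤ) p, f p c) := by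
  induction S using Finset.induction_on with
  | empty =>
    refine ⟨fun _ => 1, by simp, by simp⟩
  | insert a S ha ih =>
    obtain ⟨h, h1, h2⟩ := ih (fun p hp => hS p (Finset.mem_insert_of_mem hp))
    have hap := hS a (Finset.mem_insert_self _ _)
    have hS0 : ∏ p ∈ S, p ≠ 0 := Finset.prod_ne_zero_iff.2 (fun p hp => (hS p (Finset.mem_insert_of_mem hp)).ne_zero)
    have : NeZero a := ⟨hap.ne_zero⟩
    have : NeZero (∏ p ∈ S, p) := ⟨hS0⟩
    have : NeZero (a * ∏ p ∈ S, p) := ⟨mul_ne_zero hap.ne_zero hS0⟩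
    have hc : Nat.Coprime a (∏ p ∈ S, p) := by
      apply Nat.Coprime.prod_right
      intro p hp
      rw [Nat.coprime_primes hap (hS p (Finset.mem_insert_of_mem hp))]
      rintro rfl; exact ha hp
    obtain ⟨k, k1, k2⟩ := zmod_crt_sum a _ hc (f a) h
    rw [Finset.prod_insert ha]
    refine ⟨k, ?_, ?_⟩
    · intro c; rw [k1, h1, Finset.prod_insert ha]
    · intro u
      rw [sum_Ico_zmod, k2, Finset.prod_insert ha, ← h2 0, ← sum_Ico_zmod _ h 0]
      congr 1
      have := sum_Ico_zmod a (f a) 0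
      simp only [zero_add] at this
      exact this.symm

lemma sieve_bound (f : (p : ℕ) → ZMod p → ℝ) (Z : ℕ) (Q : ℕ → Prop) [DecidablePred Q]
    (hQ : ∀ p, Q p → p.Prime)
    (hf : ∀ p, Q p → ∀ x, 0 ≤ f p x ∧ f p x ≤ 1)
    (hsum : ∀ p, Q p → ∑ c ∈ Finset.Ico (0:ℤ) p, f p c = 1) (u : ℤ) (M r : ℕ) :
    ∑ c ∈ Finset.Ico u (u + M), ∏ p ∈ (Finset.range (Z+1)).filter Q, (1 - f p c) ≤
      M * ∏ p ∈ (Finset.range (Z+1)).filter Q, (1 - 1/(p:ℝ)) +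
      M * ((1 + Real.log Z)^(2*r+1) / ((2*r+1).factorial : ℝ)) + ((Z:ℝ)+1)^(2*r) := by
  have hQ2 : ∀ p, Q p → 2 ≤ p := fun p hp => (hQ p hp).two_le
  set P := (Finset.range (Z+1)).filter Q with hP
  have hPQ : ∀ p ∈ P, Q p := fun p hp => (Finset.mem_filter.1 hp).2
  have hcard : P.card ≤ Z := by
    have : P ⊆ Finset.Icc 1 Z := by
      intro p hp
      have h2 := hQ2 p (hPQ p hp)
      simp only [hP, Finset.mem_filter, Finset.mem_range] at hp
      rw [Finset.mem_Icc]; omega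
    simpa using Finset.card_le_card this
  -- mean of `1/p`
  have hinv : ∀ p ∈ P, 0 ≤ 1/(p:ℝ) ∧ 1/(p:ℝ) ≤ 1 := by
    intro p hp
    have h2 := hQ2 p (hPQ p hp)
    have : (1:ℝ) ≤ p := by exact_mod_cast (by omega)
    refine ⟨by positivity, ?_⟩
    rw [div_le_one (by linarith)]; exact this
  have b1 := bonferroni (fun p : ℕ => 1/(p:ℝ)) P hinv (2*r+2)
  rw [Finset.sum_range_succ] at b1
  have e1 : (-1:ℝ)^(2*r+2) = 1 := by rw [show 2*r+2 = 2*(r+1) by ring, pow_mul]; simp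
  have e2 : (-1:ℝ)^(2*r+1) = -1 := by rw [pow_succ, pow_mul]; simp
  rw [e1, e2] at b1
  have hesy := esy_le (fun p : ℕ => 1/(p:ℝ)) P (fun p hp => (hinv p hp).1) (2*r+1)
  have hesy2 : (∑ p ∈ P, 1/(p:ℝ))^(2*r+1) / ((2*r+1).factorial : ℝ) ≤
      (1 + Real.log Z)^(2*r+1) / ((2*r+1).factorial : ℝ) := by
    have := sum_upper Q hQ2 Z
    have h0 : 0 ≤ ∑ p ∈ P, 1/(p:ℝ) := Finset.sum_nonneg (fun p hp => (hinv p hp).1)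
    gcongr
  -- pointwise
  have key : ∀ j : ℕ, (-1:ℝ)^j * ∑ c ∈ Finset.Ico u (u + M), esy P (fun p => f p c) j ≤
      M * ((-1:ℝ)^j * esy P (fun p : ℕ => 1/(p:ℝ)) j) + (P.powersetCard j).card := by
    intro j
    unfold esy
    rw [Finset.sum_comm, Finset.mul_sum, Finset.mul_sum, Finset.mul_sum, Finset.card_eq_sum_ones,
      Nat.cast_sum, ← Finset.sum_add_distrib]
    apply Finset.sum_le_sum
    intro S hS
    rw [Finset.mem_powersetCard] at hS
    have hSp : ∀ p ∈ S, p.Prime := fun p hp => hQ p (hPQ p (hS.1 hp))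
    obtain ⟨h, h1, h2⟩ := zmod_prod_sum f S hSp
    have hS0 : ∏ p ∈ S, p ≠ 0 := Finset.prod_ne_zero_iff.2 (fun p hp => (hSp p hp).ne_zero)
    have : NeZero (∏ p ∈ S, p) := ⟨hS0⟩
    have h3 : ∑ x, h x = 1 := by
      rw [← sum_Ico_zmod _ h 0, h2 0]
      exact Finset.prod_eq_one (fun p hp => hsum p (hPQ p (hS.1 hp)))
    have h4 : ∀ x, 0 ≤ h x := by
      intro x
      obtain ⟨c, rfl⟩ := ZMod.intCast_surjective x
      rw [h1]
      exact Finset.prod_nonneg (fun p hp => (hf p (hPQ p (hS.1 hp)) _).1)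
    have := sum_Ico_approx _ h h4 h3 u M
    simp only [h1] at this
    have hq : (1:ℝ)/((∏ p ∈ S, p : ℕ):ℝ) = ∏ p ∈ S, 1/(p:ℝ) := by
      push_cast; rw [Finset.prod_div_distrib]; simp
    rw [hq, abs_le] at this
    push_cast
    rcases neg_one_pow_eq_or ℝ j with h | h <;> rw [h] <;> linarith [this.1, this.2]
  calc _ ≤ ∑ c ∈ Finset.Ico u (u + M), ∑ j ∈ Finset.range (2*r+1), (-1:ℝ)^j * esy P (fun p => f p c) j := by
        apply Finset.sum_le_sum
        intro c _
        have := bonferroni (fun p => f p c) P (fun p hp => hf p (hPQ p hp) _) (2*r+1)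
        rw [e2] at this
        linarith
    _ = ∑ j ∈ Finset.range (2*r+1), (-1:ℝ)^j * ∑ c ∈ Finset.Ico u (u + M), esy P (fun p => f p c) j := by
        rw [Finset.sum_comm]
        simp only [Finset.mul_sum]
    _ ≤ ∑ j ∈ Finset.range (2*r+1), (M * ((-1:ℝ)^j * esy P (fun p : ℕ => 1/(p:ℝ)) j) + (P.powersetCard j).card) :=
        Finset.sum_le_sum (fun j _ => key j)
    _ = M * ∑ j ∈ Finset.range (2*r+1), ((-1:ℝ)^j * esy P (fun p : ℕ => 1/(p:ℝ)) j) +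
        ∑ j ∈ Finset.range (2*r+1), ((P.powersetCard j).card : ℝ) := by
        rw [Finset.sum_add_distrib, Finset.mul_sum]
    _ ≤ M * (∏ p ∈ P, (1 - 1/(p:ℝ)) + (1 + Real.log Z)^(2*r+1) / ((2*r+1).factorial : ℝ)) + ((Z:ℝ)+1)^(2*r) := by
        apply add_le_add _ (esy_count P (2*r) Z hcard)
        apply mul_le_mul_of_nonneg_left _ (by positivity)
        linarith
    _ = _ := by ring

/-- local count of the residues avoided -/
lemma local_count (p : ℕ) (hp : p.Prime) (n m a b : ℤ) (hnm : ¬ ((p:ℤ) ∣ n ∧ (p:ℤ) ∣ m)) :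
    ∑ c ∈ Finset.Ico (0:ℤ) p, (if ((a:ZMod p) + c * n ≠ 0 ∧ (b : ZMod p) + c * m ≠ 0) then (1:ℝ) else 0) ≤
      p * ((1 - 1/(p:ℝ)) * (if (p:ℤ) ∣ n * m ∨ (p:ℤ) ∣ a * m - b * n then 1 else 1 - 1/((p:ℝ)-1))) := by
  have : Fact p.Prime := ⟨hp⟩
  have hp2 : (2:ℝ) ≤ p := by exact_mod_cast hp.two_le
  have e := sum_Ico_zmod p (fun x => if ((a:ZMod p) + x * n ≠ 0 ∧ (b : ZMod p) + x * m ≠ 0) then (1:ℝ) else 0) 0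
  rw [zero_add] at e
  rw [e]
  classical
  rw [← Finset.sum_filter, Finset.sum_const, nsmul_eq_mul, mul_one]
  set A := Finset.univ.filter (fun x : ZMod p => (a:ZMod p) + x * n ≠ 0 ∧ (b : ZMod p) + x * m ≠ 0)
  have hcu : (Finset.univ : Finset (ZMod p)).card = p := by rw [Finset.card_univ, ZMod.card]
  split_ifs with h
  · have : ∃ x0 : ZMod p, x0 ∉ A := by
      rw [not_and_or] at hnm
      rcases hnm with h | h
      · rw [← ZMod.intCast_zmod_eq_zero_iff_dvd] at h
        refine ⟨-a/n, ?_⟩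
        simp [A, h]
      · rw [← ZMod.intCast_zmod_eq_zero_iff_dvd] at h
        refine ⟨-b/m, ?_⟩
        simp [A, h]
    obtain ⟨x0, hx0⟩ := this
    have h1 : A ⊆ Finset.univ.erase x0 := fun x hx => by
      rw [Finset.mem_erase]; exact ⟨fun h => hx0 (h ▸ hx), Finset.mem_univ _⟩
    have h2 := Finset.card_le_card h1
    rw [Finset.card_erase_of_mem (Finset.mem_univ _), hcu] at h2
    have h3 : (A.card:ℝ) ≤ ((p-1:ℕ):ℝ) := by exact_mod_cast h2
    rw [Nat.cast_sub hp.one_le] at h3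
    refine h3.trans (le_of_eq ?_)
    field_simp; push_cast; ring
  · rw [not_or] at h
    have hn : (n:ZMod p) ≠ 0 := fun h' => h.1 (by
      rw [← ZMod.intCast_zmod_eq_zero_iff_dvd]; push_cast; rw [h']; simp)
    have hm : (m:ZMod p) ≠ 0 := fun h' => h.1 (by
      rw [← ZMod.intCast_zmod_eq_zero_iff_dvd]; push_cast; rw [h']; simp)
    have hc : (a:ZMod p) * m - b * n ≠ 0 := fun h' => h.2 (by
      rw [← ZMod.intCast_zmod_eq_zero_iff_dvd]; push_cast; exact h')
    have hne : -(b:ZMod p)/m ≠ -(a:ZMod p)/n := by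
      intro h'
      rw [div_eq_div_iff hm hn] at h'
      apply hc; linear_combination h'
    have h1 : A ⊆ (Finset.univ.erase (-(a:ZMod p)/n)).erase (-(b:ZMod p)/m) := fun x hx => by
      rw [Finset.mem_erase, Finset.mem_erase]
      simp only [A, Finset.mem_filter] at hx
      refine ⟨?_, ?_, Finset.mem_univ _⟩
      · rintro rfl; apply hx.2.2; field_simp; ring
      · rintro rfl; apply hx.2.1; field_simp; ring
    have h2 := Finset.card_le_card h1
    rw [Finset.card_erase_of_mem (by simp [hne]), Finset.card_erase_of_mem (Finset.mem_univ _), hcu] at h2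
    have h3 : (A.card:ℝ) ≤ ((p-1-1:ℕ):ℝ) := by exact_mod_cast h2
    rw [Nat.sub_sub, Nat.cast_sub hp.two_le] at h3
    refine h3.trans (le_of_eq ?_)
    have : (p:ℝ) - 1 ≠ 0 := by linarith
    field_simp; push_cast; ring

/-- number of solutions of `a m' - b n' = c` -/
lemma sol_count (n' m' d : ℕ) (hm' : 0 < m') (hd : 0 < d)
    (hco : Nat.Coprime n' m') (hm : 2 ≤ d * m') (c : ℤ) :
    (((Finset.range (d*n'+1) ×ˢ Finset.range (d*m'+1)).filter (fun x : ℕ × ℕ =>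
      (Nat.Coprime x.1 (d*n') ∧ Nat.Coprime x.2 (d*m')) ∧ (x.1:ℤ) * m' - x.2 * n' = c)).card : ℝ) ≤
    d * ∏ p ∈ d.primeFactors, ((1 - 1/(p:ℝ)) *
      (if (p:ℤ) ∣ n' * m' ∨ (p:ℤ) ∣ c then 1 else 1 - 1/((p:ℝ)-1))) := by
  set A := (Finset.range (d*n'+1) ×ˢ Finset.range (d*m'+1)).filter (fun x : ℕ × ℕ =>
      (Nat.Coprime x.1 (d*n') ∧ Nat.Coprime x.2 (d*m')) ∧ (x.1:ℤ) * m' - x.2 * n' = c) with hA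
  rcases A.eq_empty_or_nonempty with h0 | ⟨⟨a0, b0⟩, h0⟩
  · rw [h0]
    simp only [Finset.card_empty, Nat.cast_zero]
    apply mul_nonneg (by positivity)
    apply Finset.prod_nonneg
    intro p hp
    have hp2 : (2:ℝ) ≤ p := by exact_mod_cast (Nat.prime_of_mem_primeFactors hp).two_le
    apply mul_nonneg
    · rw [sub_nonneg, div_le_one (by linarith)]; linarith
    · split_ifs
      · norm_num
      · rw [sub_nonneg, div_le_one (by linarith)]; linarith
  simp only [hA, Finset.mem_filter, Finset.mem_product, Finset.mem_range] at h0
  obtain ⟨-, -, hc0⟩ := h0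
  classical
  let f : (p : ℕ) → ZMod p → ℝ := fun p x =>
    if (((a0:ℤ):ZMod p) + x * (n':ℤ) ≠ 0 ∧ ((b0:ℤ) : ZMod p) + x * (m':ℤ) ≠ 0) then (1:ℝ) else 0
  set u : ℤ := -((b0:ℤ) / m')
  have hinj : A.card ≤ ((Finset.Ico u (u+d)).filter (fun t : ℤ => ∀ p ∈ d.primeFactors,
      (((a0:ℤ):ZMod p) + t * (n':ℤ) ≠ 0 ∧ ((b0:ℤ) : ZMod p) + t * (m':ℤ) ≠ 0))).card := by
    have hm0 : (m':ℤ) ≠ 0 := by exact_mod_cast hm'.ne'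
    have hst : ∀ x ∈ A, (x.2:ℤ) = b0 + ((x.2:ℤ)/m' - (b0:ℤ)/m') * m' ∧
        (x.1:ℤ) = a0 + ((x.2:ℤ)/m' - (b0:ℤ)/m') * n' := by
      rintro ⟨a, b⟩ hx
      simp only [hA, Finset.mem_filter, Finset.mem_product, Finset.mem_range] at hx
      obtain ⟨-, -, hc⟩ := hx
      have h1 : (m':ℤ) ∣ ((b:ℤ) - b0) * n' := ⟨a - a0, by linarith⟩
      have h2 : (m':ℤ) ∣ (b:ℤ) - b0 := by
        refine IsCoprime.dvd_of_dvd_mul_right ?_ h1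
        exact (Nat.isCoprime_iff_coprime.2 hco).symm
      obtain ⟨t, ht⟩ := h2
      have h3 : (b:ℤ) = b0 + t * m' := by linarith
      have h4 : (b:ℤ) / m' - (b0:ℤ)/m' = t := by
        rw [h3, Int.add_mul_ediv_right _ _ hm0]; ring
      simp only
      rw [h4]
      refine ⟨h3, ?_⟩
      have : ((a:ℤ) - a0 - t * n') * m' = 0 := by
        rw [h3] at hc; linear_combination hc - hc0
      rcases mul_eq_zero.1 this with h | h
      · linarith
      · exact absurd h hm0
    apply Finset.card_le_card_of_injOn (fun x : ℕ × ℕ => (x.2:ℤ)/m' - (b0:ℤ)/m')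
    · intro x hx
      obtain ⟨e2, e1⟩ := hst x hx
      have hx' := hx
      simp only [hA, Finset.coe_filter, Finset.mem_product, Finset.mem_range, Set.mem_ofPred_eq] at hx'
      obtain ⟨⟨hr1, hr2⟩, ⟨hc1, hc2⟩, hc⟩ := hx'
      have hlt : x.2 < d * m' := by
        rcases lt_or_eq_of_le (Nat.lt_succ_iff.1 hr2) with h | h
        · exact h
        · rw [h, Nat.coprime_self] at hc2; omega
      rw [Finset.mem_coe, Finset.mem_filter, Finset.mem_Ico]
      refine ⟨⟨?_, ?_⟩, ?_⟩
      · have : 0 ≤ (x.2:ℤ)/m' := by positivity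
        simp only [u]; linarith
      · have : (x.2:ℤ)/m' < d := by
          rw [Int.ediv_lt_iff_lt_mul (by exact_mod_cast hm')]; exact_mod_cast hlt
        simp only [u]; linarith
      · intro p hp
        have hpp := Nat.prime_of_mem_primeFactors hp
        have hpd := Nat.dvd_of_mem_primeFactors hp
        beta_reduce
        generalize (x.2:ℤ)/m' - (b0:ℤ)/m' = t at e1 e2 ⊢
        constructor
        · intro h
          have h' : (((a0:ℤ) + t * (n':ℤ) : ℤ) : ZMod p) = 0 := by push_cast at h ⊢; exact h
          rw [← e1, ZMod.intCast_zmod_eq_zero_iff_dvd] at h'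
          have h'' : p ∣ x.1 := by exact_mod_cast h'
          exact hpp.one_lt.ne' (Nat.eq_one_of_dvd_coprimes hc1 h'' (hpd.mul_right _))
        · intro h
          have h' : (((b0:ℤ) + t * (m':ℤ) : ℤ) : ZMod p) = 0 := by push_cast at h ⊢; exact h
          rw [← e2, ZMod.intCast_zmod_eq_zero_iff_dvd] at h'
          have h'' : p ∣ x.2 := by exact_mod_cast h'
          exact hpp.one_lt.ne' (Nat.eq_one_of_dvd_coprimes hc2 h'' (hpd.mul_right _))
    · intro x hx y hy hxy
      obtain ⟨e2, e1⟩ := hst x hx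
      obtain ⟨g2, g1⟩ := hst y hy
      simp only at hxy
      rw [hxy] at e1 e2
      apply Prod.ext
      · have := e1.trans g1.symm; exact_mod_cast this
      · have := e2.trans g2.symm; exact_mod_cast this
  have hS : ∀ p ∈ d.primeFactors, p.Prime := fun p hp => Nat.prime_of_mem_primeFactors hp
  obtain ⟨h, h1, h2⟩ := zmod_prod_sum f d.primeFactors hS
  have hS0 : ∏ p ∈ d.primeFactors, p ≠ 0 := Finset.prod_ne_zero_iff.2 (fun p hp => (hS p hp).ne_zero)
  have : NeZero (∏ p ∈ d.primeFactors, p) := ⟨hS0⟩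
  obtain ⟨j, hj⟩ := Nat.prod_primeFactors_dvd d
  have hb := sum_Ico_blocks _ h u j
  rw [mul_comm j, ← hj, ← sum_Ico_zmod _ h 0, h2 0] at hb
  have hcard : ((((Finset.Ico u (u+d)).filter (fun t : ℤ => ∀ p ∈ d.primeFactors,
      (((a0:ℤ):ZMod p) + t * (n':ℤ) ≠ 0 ∧ ((b0:ℤ) : ZMod p) + t * (m':ℤ) ≠ 0))).card : ℕ) : ℝ) =
      ∑ c ∈ Finset.Ico u (u+d), h c := by
    rw [Finset.card_filter, Nat.cast_sum]
    apply Finset.sum_congr rfl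
    intro t _
    rw [h1]
    simp only [f]
    rw [Finset.prod_ite_zero]
    simp
  have hA' : (A.card:ℝ) ≤ ∑ c ∈ Finset.Ico u (u+d), h c := by
    rw [← hcard]; exact_mod_cast hinj
  refine hA'.trans ?_
  rw [hb]
  calc (j:ℝ) * ∏ p ∈ d.primeFactors, ∑ c ∈ Finset.Ico (0:ℤ) p, f p c
      ≤ j * ∏ p ∈ d.primeFactors, (p * ((1 - 1/(p:ℝ)) *
      (if (p:ℤ) ∣ n' * m' ∨ (p:ℤ) ∣ c then 1 else 1 - 1/((p:ℝ)-1)))) := by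
        apply mul_le_mul_of_nonneg_left _ (by positivity)
        apply Finset.prod_le_prod
        · intro p _
          apply Finset.sum_nonneg; intro x _
          simp only [f]; split_ifs <;> norm_num
        · intro p hp
          have := local_count p (hS p hp) n' m' a0 b0 (by
            rintro ⟨h1, h2⟩
            have h1' : p ∣ n' := by exact_mod_cast h1
            have h2' : p ∣ m' := by exact_mod_cast h2
            exact (hS p hp).one_lt.ne' (Nat.eq_one_of_dvd_coprimes hco h1' h2'))
          rw [hc0] at this
          exact this
    _ = _ := by
        rw [Finset.prod_mul_distrib, ← mul_assoc]
        congr 1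
        conv_rhs => rw [hj]
        push_cast; ring

lemma sol_count' (n' m' d : ℕ) (hn' : 0 < n') (hm' : 0 < m') (hd : 0 < d)
    (hco : Nat.Coprime n' m') (hne : n' ≠ m') (c : ℤ) :
    (((Finset.range (d*n'+1) ×ˢ Finset.range (d*m'+1)).filter (fun x : ℕ × ℕ =>
      (Nat.Coprime x.1 (d*n') ∧ Nat.Coprime x.2 (d*m')) ∧ (x.1:ℤ) * m' - x.2 * n' = c)).card : ℝ) ≤
    d * ∏ p ∈ d.primeFactors, ((1 - 1/(p:ℝ)) *
      (if (p:ℤ) ∣ n' * m' ∨ (p:ℤ) ∣ c then 1 else 1 - 1/((p:ℝ)-1))) := by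
  by_cases hm : 2 ≤ d * m'
  · exact sol_count n' m' d hm' hd hco hm c
  · have h1 : d * m' = 1 := by
      have : 0 < d * m' := by positivity
      omega
    have hd1 : d = 1 := Nat.eq_one_of_mul_eq_one_right h1
    have hm1 : m' = 1 := Nat.eq_one_of_mul_eq_one_left h1
    have h2 : 2 ≤ d * n' := by
      rw [hd1]; omega
    have := sol_count m' n' d hn' hd hco.symm h2 (-c)
    simp only [dvd_neg, mul_comm (m':ℤ) (n':ℤ)] at this
    refine le_trans ?_ this
    rw [Nat.cast_le]
    apply Finset.card_le_card_of_injOn Prod.swap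
    · intro x hx
      simp only [Finset.coe_filter, Finset.mem_product, Finset.mem_range, Set.mem_ofPred_eq,
        Prod.fst_swap, Prod.snd_swap] at hx ⊢
      refine ⟨⟨hx.1.2, hx.1.1⟩, ⟨hx.2.1.2, hx.2.1.1⟩, by linarith [hx.2.2]⟩
    · intro x _ y _ h
      exact Prod.swap_injective h

/-- local weights -/
noncomputable def fw (N p : ℕ) (x : ZMod p) : ℝ :=
  open Classical in
  if p ∣ N then (if x = 0 then 1 else 0) else (if x = 0 then 0 else 1/((p:ℝ)-1))

lemma fw_bd (N p : ℕ) (hp : p.Prime) (x : ZMod p) : 0 ≤ fw N p x ∧ fw N p x ≤ 1 := by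
  have hp2 : (2:ℝ) ≤ p := by exact_mod_cast hp.two_le
  have : 0 ≤ 1/((p:ℝ)-1) := by apply div_nonneg <;> linarith
  have : 1/((p:ℝ)-1) ≤ 1 := by rw [div_le_one (by linarith)]; linarith
  unfold fw
  split_ifs <;> constructor <;> linarith

lemma fw_sum (N p : ℕ) (hp : p.Prime) : ∑ c ∈ Finset.Ico (0:ℤ) p, fw N p c = 1 := by
  classical
  have : Fact p.Prime := ⟨hp⟩
  have hp2 : (2:ℝ) ≤ p := by exact_mod_cast hp.two_le
  have e := sum_Ico_zmod p (fw N p) 0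
  rw [zero_add] at e
  rw [e]
  unfold fw
  by_cases h : p ∣ N
  · simp [h]
  · simp only [h, if_false]
    have : ∀ x : ZMod p, (if x = 0 then (0:ℝ) else 1/((p:ℝ)-1)) = 1/((p:ℝ)-1) - (if x = 0 then 1/((p:ℝ)-1) else 0) := by
      intro x; split_ifs <;> simp
    simp only [this]
    rw [Finset.sum_sub_distrib, Finset.sum_ite_eq', Finset.sum_const, Finset.card_univ, ZMod.card]
    simp only [Finset.mem_univ, if_true, nsmul_eq_mul]
    have : (p:ℝ) - 1 ≠ 0 := by linarith
    field_simp

lemma pw_bound (N d : ℕ) (c : ℤ) (Z : ℕ) (G : ℝ) (hN : 0 < N) (hd : 0 < d)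
    (hc : ∀ p : ℕ, p.Prime → p ∣ N → ¬ (p:ℤ) ∣ c)
    (hG : ∀ Q : Finset ℕ, (∀ p ∈ Q, p.Prime ∧ Z < p ∧ (p:ℤ) ∣ c) → ∏ p ∈ Q, (1 - 1/(p:ℝ))⁻¹ ≤ G) :
    ∏ p ∈ d.primeFactors, (if (p:ℤ) ∣ N ∨ (p:ℤ) ∣ c then (1:ℝ) else 1 - 1/((p:ℝ)-1)) ≤
    (∏ p ∈ d.primeFactors.filter (fun p => ¬ p ∣ N ∧ Z < p), (1 - 1/(p:ℝ))) * G *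
      ∏ p ∈ (Finset.range (Z+1)).filter (fun p => p.Prime ∧ p ∣ d * N), (1 - fw N p c) := by
  classical
  set g : ℕ → ℝ := fun p => (if (p:ℤ) ∣ N ∨ (p:ℤ) ∣ c then (1:ℝ) else 1 - 1/((p:ℝ)-1)) with hg
  have h1 : ∏ p ∈ d.primeFactors, g p = ∏ p ∈ d.primeFactors.filter (fun p => ¬ p ∣ N), g p := by
    symm
    apply Finset.prod_filter_of_ne
    intro p _ h hpn
    apply h
    have : (p:ℤ) ∣ N := by exact_mod_cast hpn
    simp [hg, this]
  have h2 : ∏ p ∈ (Finset.range (Z+1)).filter (fun p => p.Prime ∧ p ∣ d * N), (1 - fw N p c)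
      = ∏ p ∈ ((Finset.range (Z+1)).filter (fun p => p.Prime ∧ p ∣ d * N)).filter (fun p => ¬ p ∣ N), (1 - fw N p c) := by
    symm
    apply Finset.prod_filter_of_ne
    intro p hp h hpn
    apply h
    have := hc p (Finset.mem_filter.1 hp).2.1 hpn
    rw [← ZMod.intCast_zmod_eq_zero_iff_dvd] at this
    simp [fw, hpn, this]
  have h3 : ((Finset.range (Z+1)).filter (fun p => p.Prime ∧ p ∣ d * N)).filter (fun p => ¬ p ∣ N) =
      (d.primeFactors.filter (fun p => ¬ p ∣ N)).filter (fun p => ¬ Z < p) := by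
    ext p
    simp only [Finset.mem_filter, Finset.mem_range, Nat.mem_primeFactors]
    constructor
    · rintro ⟨⟨a, b, e⟩, f⟩
      exact ⟨⟨⟨b, (b.dvd_mul.1 e).resolve_right f, hd.ne'⟩, f⟩, by omega⟩
    · rintro ⟨⟨⟨a, b, e⟩, f⟩, h⟩
      exact ⟨⟨by omega, a, b.mul_right _⟩, f⟩
  have h4 : d.primeFactors.filter (fun p => ¬ p ∣ N ∧ Z < p) =
      (d.primeFactors.filter (fun p => ¬ p ∣ N)).filter (fun p => Z < p) := by
    rw [Finset.filter_filter]
  rw [h1, h2, h3, h4, ← Finset.prod_filter_mul_prod_filter_not _ (fun p => Z < p)]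
  set D' := d.primeFactors.filter (fun p => ¬ p ∣ N)
  have hD' : ∀ p ∈ D', p.Prime ∧ ¬ p ∣ N := fun p hp => by
    simp only [D', Finset.mem_filter, Nat.mem_primeFactors] at hp; exact ⟨hp.1.1, hp.2⟩
  have h5 : ∏ p ∈ D'.filter (fun p => ¬ Z < p), (1 - fw N p c) = ∏ p ∈ D'.filter (fun p => ¬ Z < p), g p := by
    apply Finset.prod_congr rfl
    intro p hp
    obtain ⟨hp1, hp2⟩ := hD' p (Finset.mem_filter.1 hp).1
    have h2' : ¬ (p:ℤ) ∣ N := by exact_mod_cast hp2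
    simp only [fw, hp2, if_false, hg, h2', false_or, ZMod.intCast_zmod_eq_zero_iff_dvd]
    split_ifs <;> simp
  rw [h5]
  have hg0 : ∀ p : ℕ, p.Prime → 0 ≤ g p := by
    intro p hp
    have hp2 : (2:ℝ) ≤ p := by exact_mod_cast hp.two_le
    have : 1/((p:ℝ)-1) ≤ 1 := by rw [div_le_one (by linarith)]; linarith
    simp only [hg]; split_ifs <;> linarith
  apply mul_le_mul_of_nonneg_right
  · have hk : ∏ p ∈ D'.filter (fun p => Z < p), g p ≤ ∏ p ∈ D'.filter (fun p => Z < p),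
        ((1 - 1/(p:ℝ)) * (if (p:ℤ) ∣ c then (1 - 1/(p:ℝ))⁻¹ else 1)) := by
      apply Finset.prod_le_prod
      · intro p hp; exact hg0 p (hD' p (Finset.mem_filter.1 hp).1).1
      · intro p hp
        obtain ⟨hp1, hp2⟩ := hD' p (Finset.mem_filter.1 hp).1
        have h2' : ¬ (p:ℤ) ∣ N := by exact_mod_cast hp2
        have hp2 : (2:ℝ) ≤ p := by exact_mod_cast hp1.two_le
        have : 1/(p:ℝ) < 1 := by rw [div_lt_one (by linarith)]; linarith
        simp only [hg, h2', false_or]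
        split_ifs
        · rw [mul_inv_cancel₀ (by linarith)]
        · have : 1/(p:ℝ) ≤ 1/((p:ℝ)-1) := one_div_le_one_div_of_le (by linarith) (by linarith)
          linarith
    refine hk.trans ?_
    rw [Finset.prod_mul_distrib, ← Finset.prod_filter]
    apply mul_le_mul_of_nonneg_left
    · apply hG
      intro p hp
      simp only [Finset.mem_filter] at hp
      exact ⟨(hD' p hp.1.1).1, hp.1.2, hp.2⟩
    · apply Finset.prod_nonneg
      intro p hp
      have hp2 : (2:ℝ) ≤ p := by exact_mod_cast (hD' p (Finset.mem_filter.1 hp).1).1.two_le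
      have : 1/(p:ℝ) < 1 := by rw [div_lt_one (by linarith)]; linarith
      linarith
  · exact Finset.prod_nonneg (fun p hp => hg0 p (hD' p (Finset.mem_filter.1 hp).1).1)

lemma tot_real (d : ℕ) : (d.totient : ℝ) = d * ∏ p ∈ d.primeFactors, (1 - 1/(p:ℝ)) := by
  have := Nat.totient_eq_mul_prod_factors d
  have h : ((d.totient : ℚ) : ℝ) = ((d * ∏ p ∈ d.primeFactors, (1 - (p:ℚ)⁻¹) : ℚ) : ℝ) := by rw [this]
  push_cast at h
  simpa [one_div] using h

lemma tot_mul (n' m' d : ℕ) (hn' : 0 < n') (hm' : 0 < m') (hd : 0 < d) (hco : Nat.Coprime n' m') :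
    ((d*n').totient : ℝ) * ((d*m').totient : ℝ) =
      d.totient * ((d * (n' * m') : ℕ) * ∏ p ∈ (d*(n'*m')).primeFactors, (1 - 1/(p:ℝ))) := by
  have h := Nat.totient_gcd_mul_totient_mul (d*n') (d*m')
  rw [Nat.gcd_mul_left, hco.gcd_eq_one, mul_one] at h
  have h' : (d.totient : ℝ) * ((d*n'*(d*m')).totient : ℝ) = (d*n').totient * (d*m').totient * d := by
    exact_mod_cast h
  rw [tot_real (d*n'*(d*m'))] at h'
  have hpf : (d*n'*(d*m')).primeFactors = (d*(n'*m')).primeFactors := by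
    ext p
    simp only [Nat.mem_primeFactors, ne_eq]
    constructor
    · rintro ⟨a, b, _⟩
      refine ⟨a, ?_, by positivity⟩
      rw [show d*n'*(d*m') = d*(d*(n'*m')) by ring, a.dvd_mul] at b
      rcases b with b | b
      · exact b.mul_right _
      · exact b
    · rintro ⟨a, b, _⟩
      refine ⟨a, ?_, by positivity⟩
      rw [show d*n'*(d*m') = d*(d*(n'*m')) by ring]
      exact b.mul_left _
  rw [hpf] at h'
  have hd' : (d:ℝ) ≠ 0 := by exact_mod_cast hd.ne'
  apply mul_right_cancel₀ hd'
  rw [← h']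
  push_cast
  ring

lemma prod_split (N d Z : ℕ) (hN : 0 < N) (hd : 0 < d) :
    (∏ p ∈ d.primeFactors.filter (fun p => ¬ p ∣ N ∧ Z < p), (1 - 1/(p:ℝ))) *
      ∏ p ∈ (Finset.range (Z+1)).filter (fun p => p.Prime ∧ p ∣ d * N), (1 - 1/(p:ℝ)) =
    (∏ p ∈ (d*N).primeFactors, (1 - 1/(p:ℝ))) *
      ∏ p ∈ N.primeFactors.filter (fun p => Z < p), (1 + 1/((p:ℝ)-1)) := by
  classical
  have h1 : ∏ p ∈ N.primeFactors.filter (fun p => Z < p), (1 + 1/((p:ℝ)-1)) =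
      (∏ p ∈ N.primeFactors.filter (fun p => Z < p), (1 - 1/(p:ℝ)))⁻¹ := by
    rw [← Finset.prod_inv_distrib]
    apply Finset.prod_congr rfl
    intro p hp
    have hp2 : (2:ℝ) ≤ p := by
      exact_mod_cast (Nat.prime_of_mem_primeFactors (Finset.mem_filter.1 hp).1).two_le
    have : (p:ℝ) - 1 ≠ 0 := by linarith
    field_simp
    ring
  have h0 : (∏ p ∈ N.primeFactors.filter (fun p => Z < p), (1 - 1/(p:ℝ))) ≠ 0 := by
    rw [Finset.prod_ne_zero_iff]
    intro p hp
    have hp2 : (2:ℝ) ≤ p := by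
      exact_mod_cast (Nat.prime_of_mem_primeFactors (Finset.mem_filter.1 hp).1).two_le
    have : 1/(p:ℝ) < 1 := by rw [div_lt_one (by linarith)]; linarith
    linarith
  rw [h1, eq_mul_inv_iff_mul_eq₀ h0]
  have hs1 : (Finset.range (Z+1)).filter (fun p => p.Prime ∧ p ∣ d * N) =
     (d*N).primeFactors.filter (fun p => ¬ Z < p) := by
    ext p
    simp only [Finset.mem_filter, Finset.mem_range, Nat.mem_primeFactors]
    constructor
    · rintro ⟨a, b, c⟩; exact ⟨⟨b, c, by positivity⟩, by omega⟩
    · rintro ⟨⟨a, b, c⟩, e⟩; exact ⟨by omega, a, b⟩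
  have hs2 : d.primeFactors.filter (fun p => ¬ p ∣ N ∧ Z < p) =
     ((d*N).primeFactors.filter (fun p => Z < p)).filter (fun p => ¬ p ∣ N) := by
    ext p
    simp only [Finset.mem_filter, Nat.mem_primeFactors]
    constructor
    · rintro ⟨⟨a, b, c⟩, e, f⟩; exact ⟨⟨⟨a, b.mul_right _, by positivity⟩, f⟩, e⟩
    · rintro ⟨⟨⟨a, b, c⟩, f⟩, e⟩; exact ⟨⟨a, (a.dvd_mul.1 b).resolve_right e, hd.ne'⟩, e, f⟩
  have hs3 : N.primeFactors.filter (fun p => Z < p) =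
     ((d*N).primeFactors.filter (fun p => Z < p)).filter (fun p => p ∣ N) := by
    ext p
    simp only [Finset.mem_filter, Nat.mem_primeFactors]
    constructor
    · rintro ⟨⟨a, b, c⟩, e⟩; exact ⟨⟨⟨a, b.mul_left _, by positivity⟩, e⟩, b⟩
    · rintro ⟨⟨⟨a, b, c⟩, f⟩, e⟩; exact ⟨⟨a, e, hN.ne'⟩, f⟩
  rw [hs1, hs2, hs3, ← Finset.prod_filter_mul_prod_filter_not (d*N).primeFactors (fun p => Z < p),
   ← Finset.prod_filter_mul_prod_filter_not ((d*N).primeFactors.filter (fun p => Z < p)) (fun p => p ∣ N)]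
  ring

/-- the set of coprime pairs -/
def Gs (n m : ℕ) : Finset (ℕ × ℕ) :=
  (Finset.range (n+1) ×ˢ Finset.range (m+1)).filter (fun x : ℕ × ℕ =>
      Nat.Coprime x.1 n ∧ Nat.Coprime x.2 m)

lemma sol_cop (n' m' d : ℕ) (x : ℕ × ℕ) (hx : x ∈ Gs (d*n') (d*m'))
    (hco : Nat.Coprime n' m') (p : ℕ) (hp : p.Prime) (hpN : p ∣ n' * m') :
    ¬ (p:ℤ) ∣ (x.1:ℤ) * m' - x.2 * n' := by
  intro h
  simp only [Gs, Finset.mem_filter] at hx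
  obtain ⟨-, h1, h2⟩ := hx
  rcases hp.dvd_mul.1 hpN with h' | h'
  · have : (p:ℤ) ∣ (x.1:ℤ) * m' := by
      rw [show (x.1:ℤ) * m' = ((x.1:ℤ) * m' - x.2 * n') + x.2 * n' by ring]
      exact dvd_add h (Dvd.dvd.mul_left (by exact_mod_cast h') _)
    have : p ∣ x.1 * m' := by exact_mod_cast this
    rcases hp.dvd_mul.1 this with h3 | h3
    · exact hp.one_lt.ne' (Nat.eq_one_of_dvd_coprimes h1 h3 (h'.mul_left _))
    · exact hp.one_lt.ne' (Nat.eq_one_of_dvd_coprimes hco h' h3)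
  · have : (p:ℤ) ∣ (x.2:ℤ) * n' := by
      rw [show (x.2:ℤ) * n' = (x.1:ℤ) * m' - ((x.1:ℤ) * m' - x.2 * n') by ring]
      exact dvd_sub (Dvd.dvd.mul_left (by exact_mod_cast h') _) h
    have : p ∣ x.2 * n' := by exact_mod_cast this
    rcases hp.dvd_mul.1 this with h3 | h3
    · exact hp.one_lt.ne' (Nat.eq_one_of_dvd_coprimes h2 h3 (h'.mul_left _))
    · exact hp.one_lt.ne' (Nat.eq_one_of_dvd_coprimes hco h3 h')

lemma sol_ne_zero (n' m' d : ℕ) (x : ℕ × ℕ) (hx : x ∈ Gs (d*n') (d*m'))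
    (hco : Nat.Coprime n' m') (hne : n' ≠ m') : (x.1:ℤ) * m' - x.2 * n' ≠ 0 := by
  intro h
  have : n' * m' ≠ 1 := by
    intro h1
    exact hne ((Nat.eq_one_of_mul_eq_one_right h1).trans (Nat.eq_one_of_mul_eq_one_left h1).symm)
  obtain ⟨p, hp, hpN⟩ := Nat.exists_prime_and_dvd this
  exact sol_cop n' m' d x hx hco p hp hpN (by rw [h]; exact dvd_zero _)

/-- the main counting estimate -/
lemma T_bound (n' m' d : ℕ) (hn' : 0 < n') (hm' : 0 < m') (hd : 0 < d)
    (hco : Nat.Coprime n' m') (hne : n' ≠ m') (D x : ℝ) (hD : 1/2 ≤ D) (hx : |x| ≤ D) (Z r : ℕ) (G : ℝ)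
    (hG0 : 0 ≤ G)
    (hG : ∀ c : ℤ, c ≠ 0 → |(c:ℝ)| ≤ 2 * D → 
      ∀ Q : Finset ℕ, (∀ p ∈ Q, p.Prime ∧ Z < p ∧ (p:ℤ) ∣ c) → ∏ p ∈ Q, (1 - 1/(p:ℝ))⁻¹ ≤ G) :
    (((Gs (d*n') (d*m')).filter (fun y : ℕ × ℕ => |((y.1:ℝ) * m' - y.2 * n') - x| ≤ D)).card : ℝ) * (d*(n'*m'):ℕ) ≤
     (d*n').totient * (d*m').totient * (2*D) * G *
      (1 + (2*((Z:ℝ)+1) * ((1 + Real.log Z)^(2*r+1) / ((2*r+1).factorial : ℝ)) + ((Z:ℝ)+1)^(2*r+1)/D)) *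
      ∏ p ∈ (n'*m').primeFactors.filter (fun p => Z < p), (1 + 1/((p:ℝ)-1)) := by
  classical
  set N := n' * m' with hNdef
  have hN : 0 < N := by positivity
  set B := (Gs (d*n') (d*m')).filter (fun y : ℕ × ℕ => |((y.1:ℝ) * m' - y.2 * n') - x| ≤ D) with hB
  set u : ℤ := ⌈x - D⌉ with hu
  set M : ℕ := (⌊x + D⌋ + 1 - ⌈x - D⌉).toNat with hM
  have hMi : (M:ℤ) = ⌊x + D⌋ + 1 - ⌈x - D⌉ := by
    apply Int.toNat_of_nonneg
    have h1 := Int.ceil_lt_add_one (x - D)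
    have h2 := Int.lt_floor_add_one (x + D)
    have h3 : (⌈x - D⌉ : ℝ) < ⌊x + D⌋ + 2 := by linarith
    have : ⌈x - D⌉ < ⌊x + D⌋ + 2 := by exact_mod_cast h3
    omega
  have hM2 : (M:ℝ) ≤ 2 * D + 1 := by
    have h1 := Int.le_ceil (x - D)
    have h2 := Int.floor_le (x + D)
    have : (M:ℝ) = ⌊x + D⌋ + 1 - ⌈x - D⌉ := by exact_mod_cast hMi
    linarith
  have hmem : ∀ c : ℤ, c ∈ Finset.Ico u (u + M) ↔ |(c:ℝ) - x| ≤ D := by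
    intro c
    rw [Finset.mem_Ico, hMi, hu, abs_le]
    rw [show ⌈x - D⌉ + (⌊x + D⌋ + 1 - ⌈x - D⌉) = ⌊x + D⌋ + 1 by ring, Int.lt_add_one_iff, Int.le_floor, Int.ceil_le]
    constructor <;> rintro ⟨h1, h2⟩ <;> constructor <;> linarith
  set A := ∏ p ∈ d.primeFactors.filter (fun p => ¬ p ∣ N ∧ Z < p), (1 - 1/(p:ℝ)) with hA
  have hA0 : 0 ≤ A := by
    apply Finset.prod_nonneg
    intro p hp
    have hp2 : (2:ℝ) ≤ p := by
      exact_mod_cast (Nat.prime_of_mem_primeFactors (Finset.mem_filter.1 hp).1).two_le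
    have : 1/(p:ℝ) < 1 := by rw [div_lt_one (by linarith)]; linarith
    linarith
  have hcardB : B.card = ∑ c ∈ Finset.Ico u (u+M), (B.filter (fun y => (y.1:ℤ) * m' - y.2 * n' = c)).card := by
    apply Finset.card_eq_sum_card_fiberwise
    intro y hy
    have hy' := (Finset.mem_filter.1 hy).2
    rw [Finset.mem_coe, hmem]
    push_cast; exact hy'
  have hpt : ∀ c ∈ Finset.Ico u (u+M), ((B.filter (fun y => (y.1:ℤ) * m' - y.2 * n' = c)).card : ℝ) ≤
      d.totient * A * G * ∏ p ∈ (Finset.range (Z+1)).filter (fun p => p.Prime ∧ p ∣ d * N), (1 - fw N p c) := by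
    intro c hc
    rcases (B.filter (fun y => (y.1:ℤ) * m' - y.2 * n' = c)).eq_empty_or_nonempty with h0 | ⟨y, hy⟩
    · rw [h0]
      simp only [Finset.card_empty, Nat.cast_zero]
      apply mul_nonneg (by positivity)
      apply Finset.prod_nonneg
      intro p hp
      linarith [(fw_bd N p (Finset.mem_filter.1 hp).2.1 c).2]
    · have hy1 := (Finset.mem_filter.1 hy)
      have hyG := (Finset.mem_filter.1 hy1.1).1
      have hc0 : c ≠ 0 := by
        rw [← hy1.2]; exact sol_ne_zero n' m' d y hyG hco hne
      have hcD : |(c:ℝ)| ≤ 2 * D := by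
        have h1 := (hmem c).1 hc
        rw [abs_le] at *
        constructor <;> linarith
      have hcN : ∀ p : ℕ, p.Prime → p ∣ N → ¬ (p:ℤ) ∣ c := by
        intro p hp hpN
        rw [← hy1.2]; exact sol_cop n' m' d y hyG hco p hp hpN
      have h1 := sol_count' n' m' d hn' hm' hd hco hne c
      have h2 := pw_bound N d c Z G hN hd hcN (hG c hc0 hcD)
      have h3 : ((B.filter (fun y => (y.1:ℤ) * m' - y.2 * n' = c)).card : ℝ) ≤ (((Finset.range (d*n'+1) ×ˢ Finset.range (d*m'+1)).filter (fun x : ℕ × ℕ =>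
          (Nat.Coprime x.1 (d*n') ∧ Nat.Coprime x.2 (d*m')) ∧ (x.1:ℤ) * m' - x.2 * n' = c)).card : ℝ) := by
        rw [Nat.cast_le]
        apply Finset.card_le_card
        intro z hz
        simp only [hB, Gs, Finset.mem_filter] at hz ⊢
        exact ⟨hz.1.1.1, hz.1.1.2, hz.2⟩
      refine (h3.trans h1).trans ?_
      rw [Finset.prod_mul_distrib, ← mul_assoc, ← tot_real]
      have : (N:ℤ) = n' * m' := by rw [hNdef]; push_cast; rfl
      rw [this] at h2
      refine (mul_le_mul_of_nonneg_left h2 (by positivity)).trans (le_of_eq (by ring))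
  have hsv := sieve_bound (fw N) Z (fun p => p.Prime ∧ p ∣ d * N) (fun p hp => hp.1)
    (fun p hp => fw_bd N p hp.1) (fun p hp => fw_sum N p hp.1) u M r
  have hlow := prod_lower (fun p => p.Prime ∧ p ∣ d * N) (fun p hp => hp.1.two_le) Z
  have hsplit := prod_split N d Z hN hd
  rw [tot_mul n' m' d hn' hm' hd hco, ← hNdef]
  set W := ∏ p ∈ (Finset.range (Z+1)).filter (fun p => p.Prime ∧ p ∣ d * N), (1 - 1/(p:ℝ)) with hW
  set e := ((1 + Real.log Z)^(2*r+1) / ((2*r+1).factorial : ℝ)) with he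
  have he0 : 0 ≤ e := by
    have : 0 ≤ Real.log Z := Real.log_natCast_nonneg Z
    positivity
  have hz : (0:ℝ) < (Z:ℝ)+1 := by positivity
  have hW1 : 1 ≤ ((Z:ℝ)+1) * W := by
    rw [div_le_iff₀ hz] at hlow; linarith
  have hWle : W ≤ 1 := by
    apply Finset.prod_le_one
    · intro p hp
      have hp2 : (2:ℝ) ≤ p := by exact_mod_cast (Finset.mem_filter.1 hp).2.1.two_le
      have : 1/(p:ℝ) < 1 := by rw [div_lt_one (by linarith)]; linarith
      linarith
    · intro p hp
      have : 0 ≤ 1/(p:ℝ) := by positivity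
      linarith
  have hW0 : 0 < W := lt_of_lt_of_le (by positivity) hlow
  have hD0 : 0 < D := by linarith
  have hfin : M * W + M * e + ((Z:ℝ)+1)^(2*r) ≤ 2 * D * W * (1 + (2*((Z:ℝ)+1) * e + ((Z:ℝ)+1)^(2*r+1)/D)) := by
    have a1 : M * W ≤ 2 * D * W + W := by nlinarith
    have a2 : M * e ≤ 4 * D * e := mul_le_mul_of_nonneg_right (by linarith) he0
    have a3 : 4 * D * e ≤ 4 * D * e * (((Z:ℝ)+1) * W) := le_mul_of_one_le_right (by positivity) hW1
    have a4 : ((Z:ℝ)+1)^(2*r) ≤ ((Z:ℝ)+1)^(2*r) * (((Z:ℝ)+1) * W) := le_mul_of_one_le_right (by positivity) hW1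
    have a5 : (1:ℝ) ≤ ((Z:ℝ)+1)^(2*r+1) := one_le_pow₀ (by linarith [(Nat.cast_nonneg Z : (0:ℝ) ≤ Z)])
    have a6 : W ≤ W * ((Z:ℝ)+1)^(2*r+1) := le_mul_of_one_le_right hW0.le a5
    have a7 : 2 * D * W * (1 + (2*((Z:ℝ)+1) * e + ((Z:ℝ)+1)^(2*r+1)/D)) =
      2 * D * W + 4 * D * e * (((Z:ℝ)+1) * W) + 2 * W * ((Z:ℝ)+1)^(2*r+1) := by field_simp; ring
    rw [a7]
    have a8 : ((Z:ℝ)+1)^(2*r) * (((Z:ℝ)+1) * W) = W * ((Z:ℝ)+1)^(2*r+1) := by rw [pow_succ]; ring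
    linarith
  have hB1 : (B.card:ℝ) ≤ d.totient * A * G * (2 * D * W * (1 + (2*((Z:ℝ)+1) * e + ((Z:ℝ)+1)^(2*r+1)/D))) := by
    rw [hcardB]; push_cast
    refine (Finset.sum_le_sum hpt).trans ?_
    rw [← Finset.mul_sum]
    exact mul_le_mul_of_nonneg_left (hsv.trans hfin) (by positivity)
  refine (mul_le_mul_of_nonneg_right hB1 (by positivity)).trans (le_of_eq ?_)
  linear_combination (d.totient * G * (2 * D  * (1 + (2*((Z:ℝ)+1) * e + ((Z:ℝ)+1)^(2*r+1)/D))) * ((d*N:ℕ):ℝ)) * hsplit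

open scoped ENNReal

lemma vol_lower (ψ : ℕ → ℝ) (hψ : ∀ n, ψ n ∈ Set.Icc (0:ℝ) (1/2)) (n : ℕ) (hn : 0 < n) :
    2 * (ψ n / n) * n.totient ≤ (volume (DSset ψ n)).toReal := by
  have hfin : volume (DSset ψ n) ≠ ∞ := by
    refine ne_top_of_le_ne_top ?_ (measure_mono Set.inter_subset_right)
    simp
  obtain ⟨h0, h1⟩ := hψ n
  rw [← ENNReal.ofReal_le_iff_le_toReal hfin]
  rcases Nat.lt_or_ge 1 n with hn2 | hn1
  · have hnR : (0:ℝ) < n := by exact_mod_cast hn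
    set δ := ψ n / n with hδ
    have hδ0 : 0 ≤ δ := by positivity
    have hδ1 : δ * n ≤ 1/2 := by rw [hδ, div_mul_cancel₀ _ hnR.ne']; exact h1
    have hsub : (⋃ a ∈ (Finset.range n).filter (fun a => n.Coprime a), Set.Ico ((a:ℝ)/n - δ) ((a:ℝ)/n + δ)) ⊆ DSset ψ n := by
      intro x hx
      simp only [Set.mem_iUnion, Finset.mem_filter, Finset.mem_range, exists_prop] at hx
      obtain ⟨a, ⟨ha1, ha2⟩, hx1, hx2⟩ := hx
      refine ⟨?_, ?_, ?_⟩
      · simp only [Set.mem_iUnion, exists_prop]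
        exact ⟨a, ⟨ha1.le, ha2.symm⟩, hx1, hx2.le⟩
      · have ha0 : 1 ≤ a := by
          rcases Nat.eq_zero_or_pos a with h | h
          · rw [h] at ha2; simp at ha2; omega
          · exact h
        have : (1:ℝ) ≤ a := by exact_mod_cast ha0
        refine le_trans ?_ hx1
        rw [sub_nonneg, le_div_iff₀ hnR]; linarith
      · have : (a:ℝ) + 1 ≤ n := by exact_mod_cast ha1
        refine hx2.le.trans ?_
        rw [div_add' _ _ _ hnR.ne', div_le_one hnR]; linarith
    refine le_trans ?_ (measure_mono hsub)
    rw [measure_biUnion_finset]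
    · simp only [Real.volume_Ico]
      rw [Finset.sum_congr rfl (g := fun _ => ENNReal.ofReal (2*δ)) (fun a _ => by congr 1; ring),
        Finset.sum_const, ← Nat.totient_eq_card_coprime, nsmul_eq_mul, mul_comm (2*δ),
        ENNReal.ofReal_mul (by positivity), ENNReal.ofReal_natCast]
    · have key : ∀ a b : ℕ, a < b → Disjoint (Set.Ico ((a:ℝ)/n - δ) ((a:ℝ)/n + δ)) (Set.Ico ((b:ℝ)/n - δ) ((b:ℝ)/n + δ)) := by
        intro a b hab
        rw [Set.disjoint_left]
        intro x hx hy
        have h2 : (a:ℝ) + 1 ≤ b := by exact_mod_cast hab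
        have h3 : (b:ℝ)/n - δ < (a:ℝ)/n + δ := hy.1.trans_lt hx.2
        have h4 : ((b:ℝ)/n - δ) * n < ((a:ℝ)/n + δ) * n := mul_lt_mul_of_pos_right h3 hnR
        have q1 := div_mul_cancel₀ (a:ℝ) hnR.ne'
        have q2 := div_mul_cancel₀ (b:ℝ) hnR.ne'
        rw [sub_mul, add_mul, q1, q2] at h4
        linarith
      intro a _ b _ hab
      rcases lt_or_gt_of_ne hab with h | h
      · exact key a b h
      · exact (key b a h).symm
    · intros; exact measurableSet_Ico
  · have : n = 1 := by omega
    subst this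
    have hsub : Set.Ico 0 (ψ 1) ∪ Set.Ico (1 - ψ 1) 1 ⊆ DSset ψ 1 := by
      rintro x (⟨hx1, hx2⟩ | ⟨hx1, hx2⟩)
      · refine ⟨?_, hx1, by linarith⟩
        simp only [Set.mem_iUnion, exists_prop]
        exact ⟨0, ⟨by norm_num, by simp⟩, by simp; linarith, by simp; linarith⟩
      · refine ⟨?_, by linarith, hx2.le⟩
        simp only [Set.mem_iUnion, exists_prop]
        exact ⟨1, ⟨by norm_num, by simp⟩, by simp; linarith, by simp; linarith⟩
    refine le_trans ?_ (measure_mono hsub)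
    rw [measure_union]
    · simp only [Real.volume_Ico]
      rw [← ENNReal.ofReal_add (by linarith) (by linarith)]
      apply ENNReal.ofReal_le_ofReal
      simp; linarith
    · rw [Set.disjoint_left]
      rintro x ⟨hx1, hx2⟩ ⟨hy1, hy2⟩
      linarith
    · exact measurableSet_Ico

lemma overlap_upper (ψ : ℕ → ℝ) (hψ : ∀ n, ψ n ∈ Set.Icc (0:ℝ) (1/2)) (n m : ℕ) (T : ℝ)
    (hT0 : 0 ≤ T)
    (hT : ∀ y : ℝ, |y| ≤ ψ n / n → 
      (((Gs n m).filter (fun x : ℕ × ℕ => |(x.1:ℝ)/n + y - (x.2:ℝ)/m| ≤ ψ m / m)).card : ℝ) ≤ T) :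
    (volume (DSset ψ n ∩ DSset ψ m)).toReal ≤ 2 * (ψ n / n) * T := by
  set δ := ψ n / n with hδ
  have hδ0 : 0 ≤ δ := div_nonneg (hψ n).1 (by positivity)
  set E : ℕ × ℕ → Set ℝ := fun x => {y : ℝ | |(x.1:ℝ)/n + y - (x.2:ℝ)/m| ≤ ψ m / m} with hE
  have hEm : ∀ x, MeasurableSet (E x) := by
    intro x
    apply measurableSet_le <;> fun_prop
  have hsub : DSset ψ n ∩ DSset ψ m ⊆ ⋃ x ∈ Gs n m,
      (Set.Icc ((x.1 : ℝ) / n - ψ n / n) ((x.1 : ℝ) / n + ψ n / n) ∩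
       Set.Icc ((x.2 : ℝ) / m - ψ m / m) ((x.2 : ℝ) / m + ψ m / m)) := by
    rintro z ⟨⟨h1, -⟩, ⟨h2, -⟩⟩
    simp only [Set.mem_iUnion, exists_prop] at h1 h2 ⊢
    obtain ⟨a, ⟨ha1, ha2⟩, ha⟩ := h1
    obtain ⟨b, ⟨hb1, hb2⟩, hb⟩ := h2
    refine ⟨(a,b), ?_, ha, hb⟩
    simp only [Gs, Finset.mem_filter, Finset.mem_product, Finset.mem_range]
    exact ⟨⟨by omega, by omega⟩, ha2, hb2⟩
  have hvol : volume (DSset ψ n ∩ DSset ψ m) ≤ ENNReal.ofReal (2 * δ * T) := by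
    calc volume (DSset ψ n ∩ DSset ψ m) ≤ _ := measure_mono hsub
      _ ≤ ∑ x ∈ Gs n m, volume (Set.Icc ((x.1 : ℝ) / n - ψ n / n) ((x.1 : ℝ) / n + ψ n / n) ∩
       Set.Icc ((x.2 : ℝ) / m - ψ m / m) ((x.2 : ℝ) / m + ψ m / m)) := measure_biUnion_finset_le _ _
      _ = ∑ x ∈ Gs n m, volume.restrict (Set.Icc (-δ) δ) (E x) := by
          apply Finset.sum_congr rfl
          intro x _
          rw [Measure.restrict_apply (hEm x), ← measure_preimage_add volume ((x.1:ℝ)/n)]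
          congr 1
          ext y
          simp only [Set.mem_preimage, Set.mem_inter_iff, Set.mem_Icc, hE, Set.mem_ofPred_eq, abs_le]
          constructor
          · rintro ⟨⟨h1, h2⟩, h3, h4⟩; refine ⟨⟨?_, ?_⟩, ?_, ?_⟩ <;> linarith
          · rintro ⟨⟨h1, h2⟩, h3, h4⟩; refine ⟨⟨?_, ?_⟩, ?_, ?_⟩ <;> linarith
      _ = ∑ x ∈ Gs n m, ∫⁻ y in Set.Icc (-δ) δ, (E x).indicator 1 y := by
          apply Finset.sum_congr rfl
          intro x _
          rw [lintegral_indicator_one (hEm x)]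
      _ = ∫⁻ y in Set.Icc (-δ) δ, ∑ x ∈ Gs n m, (E x).indicator 1 y := by
          rw [lintegral_finsetSum]
          intro x _
          exact measurable_one.indicator (hEm x)
      _ ≤ ∫⁻ y in Set.Icc (-δ) δ, ENNReal.ofReal T := by
          apply setLIntegral_mono measurable_const
          intro y hy
          have h := hT y (abs_le.2 hy)
          have e : ∑ x ∈ Gs n m, (E x).indicator (1 : ℝ → ℝ≥0∞) y =
            (((Gs n m).filter (fun x : ℕ × ℕ => |(x.1:ℝ)/n + y - (x.2:ℝ)/m| ≤ ψ m / m)).card : ℝ≥0∞) := by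
            rw [Finset.card_filter, Nat.cast_sum]
            apply Finset.sum_congr rfl
            intro x _
            simp only [hE, Set.indicator_apply, Set.mem_ofPred_eq]
            split_ifs <;> simp
          rw [e, ← ENNReal.ofReal_natCast]
          exact ENNReal.ofReal_le_ofReal h
      _ = ENNReal.ofReal (2 * δ * T) := by
          rw [setLIntegral_const, Real.volume_Icc, mul_comm, ← ENNReal.ofReal_mul (by linarith)]
          congr 1; ring
  exact ENNReal.toReal_le_of_le_ofReal (by positivity) hvol

lemma count_conv (ψ : ℕ → ℝ) (n' m' d : ℕ) (hn' : 0 < n') (hm' : 0 < m') (hd : 0 < d) (y : ℝ) (x : ℕ × ℕ)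
    (h : |(x.1:ℝ)/(d*n':ℕ) + y - (x.2:ℝ)/(d*m':ℕ)| ≤ ψ (d*m') / (d*m':ℕ)) :
    |((x.1:ℝ) * m' - x.2 * n') - (-(d*(n'*m'):ℕ) * y)| ≤ n' * ψ (d*m') := by
  have h1 : (0:ℝ) < n' := by exact_mod_cast hn'
  have h2 : (0:ℝ) < m' := by exact_mod_cast hm'
  have h3 : (0:ℝ) < d := by exact_mod_cast hd
  have h4 := mul_le_mul_of_nonneg_left h (by positivity : (0:ℝ) ≤ d * (n' * m'))
  rw [← abs_of_nonneg (by positivity : (0:ℝ) ≤ d * (n' * m')), ← abs_mul,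
    abs_of_nonneg (by positivity : (0:ℝ) ≤ d * (n' * m'))] at h4
  push_cast at h4 ⊢
  have e1 : (d:ℝ) * (n' * m') * ((x.1:ℝ)/(d*n') + y - (x.2:ℝ)/(d*m')) = ((x.1:ℝ) * m' - x.2 * n') - (-(d*(n'*m')) * y) := by
    field_simp; ring
  have e2 : (d:ℝ) * (n' * m') * (ψ (d*m') / (d*m')) = n' * ψ (d*m') := by
    field_simp
  rw [e1, e2] at h4
  exact h4

/-- error term -/
noncomputable def Eerr (Z r : ℕ) (D : ℝ) : ℝ :=
  2*((Z:ℝ)+1) * ((1 + Real.log Z)^(2*r+1) / ((2*r+1).factorial : ℝ)) + ((Z:ℝ)+1)^(2*r+1)/D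

/-- hypothesis on G -/
def GH (G D : ℝ) (Z : ℕ) : Prop := ∀ c : ℤ, c ≠ 0 → |(c:ℝ)| ≤ 2 * D → 
      ∀ Q : Finset ℕ, (∀ p ∈ Q, p.Prime ∧ Z < p ∧ (p:ℤ) ∣ c) → ∏ p ∈ Q, (1 - 1/(p:ℝ))⁻¹ ≤ G

lemma Eerr_nonneg (Z r : ℕ) (D : ℝ) (hD : 1/2 ≤ D) : 0 ≤ Eerr Z r D := by
  unfold Eerr
  have : 0 ≤ Real.log Z := Real.log_natCast_nonneg Z
  have : 0 < D := by linarith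
  positivity

lemma prodone_nonneg (N Z : ℕ) : 0 ≤ ∏ p ∈ N.primeFactors.filter (fun p => Z < p), (1 + 1/((p:ℝ)-1)) := by
  apply Finset.prod_nonneg
  intro p hp
  have hp2 : (2:ℝ) ≤ p := by
    exact_mod_cast (Nat.prime_of_mem_primeFactors (Finset.mem_filter.1 hp).1).two_le
  have : 0 ≤ 1/((p:ℝ)-1) := by apply div_nonneg <;> linarith
  linarith

lemma overlap_asym (ψ : ℕ → ℝ) (hψ : ∀ n, ψ n ∈ Set.Icc (0:ℝ) (1/2)) (n' m' d : ℕ) (hn' : 0 < n') (hm' : 0 < m') (hd : 0 < d)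
    (hco : Nat.Coprime n' m') (hne : n' ≠ m') (D : ℝ) (hDd : D = n' * ψ (d*m')) 
    (hle : m' * ψ (d*n') ≤ n' * ψ (d*m')) :
    (D < 1/2 → (volume (DSset ψ (d*n') ∩ DSset ψ (d*m'))).toReal ≤ 0) ∧
    (1/2 ≤ D → ∀ (Z r : ℕ) (G : ℝ), 0 ≤ G → GH G D Z →
      (volume (DSset ψ (d*n') ∩ DSset ψ (d*m'))).toReal ≤
      (volume (DSset ψ (d*n'))).toReal * (volume (DSset ψ (d*m'))).toReal * (G * (1 + Eerr Z r D)) *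
      ∏ p ∈ (n'*m').primeFactors.filter (fun p => Z < p), (1 + 1/((p:ℝ)-1))) := by
  have h1 : (0:ℝ) < n' := by exact_mod_cast hn'
  have h2 : (0:ℝ) < m' := by exact_mod_cast hm'
  have h3 : (0:ℝ) < d := by exact_mod_cast hd
  have hLpos : (0:ℝ) < (d*(n'*m'):ℕ) := by positivity
  have hxb : ∀ y : ℝ, |y| ≤ ψ (d*n') / (d*n':ℕ) → |(-(d*(n'*m'):ℕ) * y : ℝ)| ≤ D := by
    intro y hy
    rw [abs_mul, abs_neg, abs_of_pos hLpos]
    refine (mul_le_mul_of_nonneg_left hy hLpos.le).trans ?_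
    rw [hDd]
    refine le_trans (le_of_eq ?_) hle
    push_cast; field_simp
  constructor
  · intro hD
    have := overlap_upper ψ hψ (d*n') (d*m') 0 le_rfl (by
      intro y hy
      have hxy := hxb y hy
      norm_cast
      rw [Nat.le_zero, Finset.card_eq_zero, Finset.filter_eq_empty_iff]
      intro x hx hxx
      have hc := count_conv ψ n' m' d hn' hm' hd y x hxx
      rw [← hDd] at hc
      have h0 := sol_ne_zero n' m' d x hx hco hne
      have h5 : |((x.1:ℝ) * m' - x.2 * n')| < 1 := by
        rw [abs_le] at *
        rw [abs_lt]
        constructor <;> linarith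
      have h6 : |((x.1:ℤ) * m' - x.2 * n')| < 1 := by exact_mod_cast h5
      exact h0 (Int.abs_lt_one_iff.1 h6))
    simpa using this
  · intro hD Z r G hG0 hG
    set X := ∏ p ∈ (n'*m').primeFactors.filter (fun p => Z < p), (1 + 1/((p:ℝ)-1)) with hX
    have hX0 : 0 ≤ X := prodone_nonneg _ _
    have hE0 := Eerr_nonneg Z r D hD
    set T := (d*n').totient * (d*m').totient * (2*D) * G * (1 + Eerr Z r D) * X / (d*(n'*m'):ℕ) with hT
    have hT0 : 0 ≤ T := by
      have : 0 ≤ D := by linarith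
      positivity
    have := overlap_upper ψ hψ (d*n') (d*m') T hT0 (by
      intro y hy
      have hxy := hxb y hy
      have hTb := T_bound n' m' d hn' hm' hd hco hne D _ hD hxy Z r G hG0 hG
      rw [← le_div_iff₀ hLpos] at hTb
      refine le_trans ?_ hTb
      rw [Nat.cast_le]
      apply Finset.card_le_card
      intro x hx
      rw [Finset.mem_filter] at hx ⊢
      refine ⟨hx.1, ?_⟩
      rw [hDd]
      exact count_conv ψ n' m' d hn' hm' hd y x hx.2)
    refine this.trans ?_
    have v1 := vol_lower ψ hψ (d*n') (by positivity)
    have v2 := vol_lower ψ hψ (d*m') (by positivity)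
    have p1 := (hψ (d*n')).1
    have p2 := (hψ (d*m')).1
    have e : 2 * (ψ (d*n') / (d*n':ℕ)) * T = (2 * (ψ (d*n') / (d*n':ℕ)) * (d*n').totient) *
       (2 * (ψ (d*m') / (d*m':ℕ)) * (d*m').totient) * (G * (1 + Eerr Z r D)) * X := by
      rw [hT, hDd]; push_cast; field_simp
    rw [e]
    apply mul_le_mul_of_nonneg_right _ hX0
    apply mul_le_mul_of_nonneg_right _ (by positivity)
    exact mul_le_mul v1 v2 (by positivity) (by positivity)

lemma overlap_sym (ψ : ℕ → ℝ) (hψ : ∀ n, ψ n ∈ Set.Icc (0:ℝ) (1/2)) (n m : ℕ) (hn : 0 < n) (hm : 0 < m)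
    (hne : n ≠ m) :
    (Dfun ψ n m < 1/2 → (volume (DSset ψ n ∩ DSset ψ m)).toReal ≤ 0) ∧
    (1/2 ≤ Dfun ψ n m → ∀ (Z r : ℕ) (G : ℝ), 0 ≤ G → GH G (Dfun ψ n m) Z →
      (volume (DSset ψ n ∩ DSset ψ m)).toReal ≤
      (volume (DSset ψ n)).toReal * (volume (DSset ψ m)).toReal * (G * (1 + Eerr Z r (Dfun ψ n m))) *
      ∏ p ∈ (n * m / Nat.gcd n m ^ 2).primeFactors.filter (fun p => Z < p), (1 + 1/((p:ℝ)-1))) := by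
  obtain ⟨d, n', m', hd, hco, rfl, rfl⟩ : ∃ d n' m' : ℕ, 0 < d ∧ Nat.Coprime n' m' ∧ n = d * n' ∧ m = d * m' := by
    obtain ⟨n', m', h1, h2, h3⟩ := Nat.exists_coprime n m
    exact ⟨Nat.gcd n m, n', m', Nat.gcd_pos_of_pos_left _ hn, h1, by rw [mul_comm]; exact h2, by rw [mul_comm]; exact h3⟩
  have hn' : 0 < n' := Nat.pos_of_mul_pos_left hn
  have hm' : 0 < m' := Nat.pos_of_mul_pos_left hm
  have hne' : n' ≠ m' := fun h => hne (by rw [h])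
  have hg : Nat.gcd (d*n') (d*m') = d := by rw [Nat.gcd_mul_left, hco.gcd_eq_one, mul_one]
  have hN : d*n'*(d*m') / Nat.gcd (d*n') (d*m') ^ 2 = n'*m' := by
    rw [hg, show d*n'*(d*m') = (n'*m')*d^2 by ring]
    exact Nat.mul_div_cancel _ (by positivity)
  have h3 : (0:ℝ) < d := by exact_mod_cast hd
  have hD : Dfun ψ (d*n') (d*m') = max (m' * ψ (d*n')) (n' * ψ (d*m')) := by
    unfold Dfun
    rw [hg]; push_cast
    rw [mul_assoc, mul_assoc, ← mul_max_of_nonneg _ _ h3.le, mul_div_cancel_left₀ _ h3.ne']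
  rw [hN]
  rcases le_total (m' * ψ (d*n')) (n' * ψ (d*m')) with h | h
  · rw [max_eq_right h] at hD
    exact overlap_asym ψ hψ n' m' d hn' hm' hd hco hne' _ hD h
  · rw [max_eq_left h] at hD
    have := overlap_asym ψ hψ m' n' d hm' hn' hd hco.symm hne'.symm _ hD h
    rw [Set.inter_comm, mul_comm n' m', mul_comm (volume (DSset ψ (d*n'))).toReal]
    exact this

lemma prod_primes_le (c : ℤ) (hc : c ≠ 0) (Q : Finset ℕ) (hQ : ∀ p ∈ Q, p.Prime ∧ (p:ℤ) ∣ c) :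
    ∏ p ∈ Q, (p:ℝ) ≤ |(c:ℝ)| := by
  have h1 : ∏ p ∈ Q, p ∣ c.natAbs :=
    Finset.prod_primes_dvd _ (fun p hp => (hQ p hp).1.prime) (fun p hp => by
      rw [← Int.natCast_dvd]; exact (hQ p hp).2)
  have h2 := Nat.le_of_dvd (Int.natAbs_pos.2 hc) h1
  have h3 : ((∏ p ∈ Q, p : ℕ):ℝ) ≤ (c.natAbs : ℝ) := by exact_mod_cast h2
  rw [Nat.cast_natAbs] at h3
  push_cast at h3
  exact h3

lemma GH_small (D : ℝ) (Z : ℕ) : GH (2*D) D Z := by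
  intro c hc hcD Q hQ
  refine le_trans ?_ ((prod_primes_le c hc Q (fun p hp => ⟨(hQ p hp).1, (hQ p hp).2.2⟩)).trans hcD)
  apply Finset.prod_le_prod
  · intro p hp
    have hp2 : (2:ℝ) ≤ p := by exact_mod_cast (hQ p hp).1.two_le
    have : 1/(p:ℝ) < 1 := by rw [div_lt_one (by linarith)]; linarith
    apply inv_nonneg.2; linarith
  · intro p hp
    have hp2 : (2:ℝ) ≤ p := by exact_mod_cast (hQ p hp).1.two_le
    rw [show 1 - 1/(p:ℝ) = (p-1)/p by field_simp, inv_div, div_le_iff₀ (by linarith)]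
    nlinarith

lemma GH_large (D : ℝ) (Z : ℕ) (hZ : 3 ≤ Z) : GH (Real.exp (Real.log (2*D) / Z)) D Z := by
  intro c hc hcD Q hQ
  have hZ' : (3:ℝ) ≤ Z := by exact_mod_cast hZ
  have hc1 : (1:ℝ) ≤ |(c:ℝ)| := by exact_mod_cast Int.one_le_abs hc
  have h0 := (prod_primes_le c hc Q (fun p hp => ⟨(hQ p hp).1, (hQ p hp).2.2⟩)).trans hcD
  have h1 : Real.exp Q.card ≤ 2 * D := by
    refine le_trans ?_ h0
    rw [← Real.exp_one_pow, ← Finset.prod_const]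
    apply Finset.prod_le_prod
    · intros; positivity
    · intro p hp
      have : (3:ℝ) ≤ p := by exact_mod_cast (by have := (hQ p hp).2.1; omega)
      linarith [Real.exp_one_lt_d9]
  have h2 : (Q.card:ℝ) ≤ Real.log (2*D) := by
    rw [Real.le_log_iff_exp_le (by linarith)]; exact h1
  calc ∏ p ∈ Q, (1 - 1/(p:ℝ))⁻¹ ≤ ∏ p ∈ Q, Real.exp (1/Z) := by
        apply Finset.prod_le_prod
        · intro p hp
          have hp2 : (2:ℝ) ≤ p := by exact_mod_cast (hQ p hp).1.two_le
          have : 1/(p:ℝ) < 1 := by rw [div_lt_one (by linarith)]; linarith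
          apply inv_nonneg.2; linarith
        · intro p hp
          have hpZ : (Z:ℝ) + 1 ≤ p := by exact_mod_cast (hQ p hp).2.1
          have e1 : (1 - 1/(p:ℝ))⁻¹ = 1 + 1/((p:ℝ)-1) := by
            have : (p:ℝ) ≠ 0 := by linarith
            have : (p:ℝ) - 1 ≠ 0 := by linarith
            field_simp; ring
          have e2 : 1/((p:ℝ)-1) ≤ 1/(Z:ℝ) := one_div_le_one_div_of_le (by linarith) (by linarith)
          have e3 := Real.add_one_le_exp (1/(Z:ℝ))
          linarith
    _ = Real.exp (Q.card / Z) := by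
        rw [Finset.prod_const, ← Real.exp_nat_mul]; congr 1; ring
    _ ≤ _ := by
        apply Real.exp_le_exp.2
        gcongr

open Filter Asymptotics in
lemma ev_cond (α β : ℝ) (h0 : 0 < α) (h1 : α < β) (h2 : β < 1/2) :
    ∀ᶠ L : ℝ in atTop, 1 ≤ L ∧ 30 * (1 + L^β) ≤ L^(1-β)/4 - 1 ∧ 6 * L^β ≤ L ∧
      (L+1) * Real.exp (L^α) ≤ Real.exp (L^β) ∧ 2 ≤ L^β := by
  have t1 := (tendsto_rpow_atTop (y := 1-2*β) (by linarith)).eventually_ge_atTop 400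
  have t2 := (tendsto_rpow_atTop (y := 1-β) (by linarith)).eventually_ge_atTop 6
  have t3 := (tendsto_rpow_atTop (y := β-α) (by linarith)).eventually_ge_atTop 2
  have t4 := (tendsto_rpow_atTop (y := β) (by linarith)).eventually_ge_atTop 4
  have t5 := (isLittleO_log_rpow_atTop (r := β) (by linarith)).bound (c := 1/4) (by norm_num)
  filter_upwards [t1, t2, t3, t4, t5, eventually_ge_atTop 1] with L a1 a2 a3 a4 a5 a6
  have hL : 0 < L := by linarith
  have e1 : L^(1-β) = L^β * L^(1-2*β) := by rw [← Real.rpow_add hL]; congr 1; ring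
  have e2 : L = L^β * L^(1-β) := by rw [← Real.rpow_add hL]; simp
  have e3 : L^β = L^α * L^(β-α) := by rw [← Real.rpow_add hL]; congr 1; ring
  have p : 0 < L^α := Real.rpow_pos_of_pos hL _
  refine ⟨a6, ?_, ?_, ?_, by linarith⟩
  · nlinarith
  · nlinarith
  · have b1 : Real.log L ≤ 1/4 * L^β := by
      have := le_trans (le_abs_self _) a5
      rwa [Real.norm_eq_abs, abs_of_nonneg (by linarith)] at this
    have b2 : L + 1 ≤ Real.exp (L^β/2) := by
      have : L ≤ Real.exp (1/4 * L^β) := by rwa [← Real.log_le_iff_le_exp hL]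
      have c2 : 2 ≤ Real.exp (1/4 * L^β) := by
        have := Real.add_one_le_exp (1/4 * L^β); linarith
      rw [show L^β/2 = 1/4 * L^β + 1/4 * L^β by ring, Real.exp_add]
      nlinarith
    have b3 : L^α ≤ L^β/2 := by nlinarith
    calc (L+1) * Real.exp (L^α) ≤ Real.exp (L^β/2) * Real.exp (L^β/2) := by gcongr
      _ = _ := by rw [← Real.exp_add]; congr 1; ring

lemma pow_fact_bd (s : ℝ) (hs : 0 ≤ s) (k : ℕ) (hk : 30 * (1 + s) ≤ k) :
    (1+s)^k / (k.factorial : ℝ) ≤ Real.exp (-(2*k)) := by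
  have e3 : Real.exp 3 ≤ 30 := by
    rw [show (3:ℝ) = ((3:ℕ):ℝ) * 1 by norm_num, Real.exp_nat_mul]
    have h1 := Real.exp_one_lt_d9
    have h2 : Real.exp 1 ≤ 3 := by linarith
    calc Real.exp 1 ^ 3 ≤ 3^3 := by gcongr
      _ ≤ 30 := by norm_num
  have h := Real.pow_div_factorial_le_exp (x := Real.exp 3 * (1+s)) (by positivity) k
  have hy : Real.exp (Real.exp 3 * (1+s)) ≤ Real.exp k := by
    apply Real.exp_le_exp.2; nlinarith
  have e : (1+s)^k / (k.factorial : ℝ) = Real.exp (-(3*k)) * ((Real.exp 3 * (1+s))^k / (k.factorial : ℝ)) := by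
    rw [mul_pow, ← Real.exp_nat_mul, show -(3*(k:ℝ)) = -(k*3) by ring, Real.exp_neg]
    field_simp
  rw [e]
  calc _ ≤ Real.exp (-(3*k)) * Real.exp k := by gcongr; exact h.trans hy
    _ = _ := by rw [← Real.exp_add]; congr 1; ring

lemma large_bd (α β D : ℝ) (hα : 0 < α) (hαβ : α < β) (hD : 1 ≤ D)
    (c1 : 1 ≤ Real.log D) (c2 : 30 * (1 + (Real.log D)^β) ≤ (Real.log D)^(1-β)/4 - 1)
    (c3 : 6 * (Real.log D)^β ≤ Real.log D)
    (c4 : (Real.log D+1) * Real.exp ((Real.log D)^α) ≤ Real.exp ((Real.log D)^β))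
    (c5 : 2 ≤ (Real.log D)^β) :
    ∃ (Z r : ℕ) (G : ℝ), 0 ≤ G ∧ GH G D Z ∧ Real.exp ((Real.log D)^α) < Z + 1 ∧
      G * (1 + Eerr Z r D) ≤ 1 + 29 * (Real.exp ((Real.log D)^α))⁻¹ := by
  have hLD : Real.log (2*D) ≤ Real.log D + 1 := by
    rw [Real.log_mul (by norm_num) (by linarith)]
    have := Real.log_two_lt_d9; linarith
  have hDe : D = Real.exp (Real.log D) := (Real.exp_log (by linarith)).symm
  set L := Real.log D with hL
  have hL0 : 0 < L := by linarith
  set s := L^β with hs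
  set f := (Real.exp (L^α))⁻¹ with hf
  have hαs : L^α ≤ s := Real.rpow_le_rpow_of_exponent_le c1 hαβ.le
  have hα1 : 1 ≤ L^α := Real.one_le_rpow c1 hα.le
  have hf0 : 0 < f := by positivity
  have hfe : f = Real.exp (-(L^α)) := by rw [Real.exp_neg]
  have hsf : Real.exp (-s) ≤ f := by rw [hfe]; apply Real.exp_le_exp.2; linarith
  have hf1 : f ≤ 1/2 := by
    rw [hf, one_div]
    apply inv_anti₀ (by norm_num)
    have := Real.add_one_le_exp (L^α); linarith
  have hz7 : 7 ≤ Real.exp s := by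
    have : Real.exp 2 ≤ Real.exp s := Real.exp_le_exp.2 c5
    have h2 : Real.exp 2 = Real.exp 1 * Real.exp 1 := by rw [← Real.exp_add]; norm_num
    nlinarith [Real.exp_one_gt_d9]
  set z := Real.exp s with hz
  have hZ1 : (⌊z⌋₊ : ℝ) ≤ z := Nat.floor_le (by positivity)
  have hZ2 : z < ⌊z⌋₊ + 1 := Nat.lt_floor_add_one z
  set Z := ⌊z⌋₊ with hZ
  have hr1 : (⌊L^(1-β)/8⌋₊ : ℝ) ≤ L^(1-β)/8 := Nat.floor_le (by positivity)
  have hr2 : L^(1-β)/8 < ⌊L^(1-β)/8⌋₊ + 1 := Nat.lt_floor_add_one _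
  set r := ⌊L^(1-β)/8⌋₊ with hr
  have hLs : s * L^(1-β) = L := by rw [hs, ← Real.rpow_add hL0]; simp
  have hk : ((2*r+1 : ℕ):ℝ) = 2*r+1 := by push_cast; ring
  have hlogZ : Real.log Z ≤ s := by
    rw [Real.log_le_iff_le_exp (by linarith)]; exact hZ1
  have hlogZ0 : 0 ≤ Real.log Z := Real.log_nonneg (by linarith)
  have T1 : (1 + Real.log Z)^(2*r+1) / ((2*r+1).factorial : ℝ) ≤ Real.exp (-(2*s)) := by
    refine le_trans ?_ ((pow_fact_bd s (by linarith) (2*r+1) (by rw [hk]; linarith)).trans ?_)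
    · gcongr
    · apply Real.exp_le_exp.2; rw [hk]; linarith
  have T1' : 2*((Z:ℝ)+1) * ((1 + Real.log Z)^(2*r+1) / ((2*r+1).factorial : ℝ)) ≤ 4 * f := by
    calc _ ≤ (4 * z) * Real.exp (-(2*s)) :=
          mul_le_mul (by linarith) T1 (by positivity) (by positivity)
      _ = 4 * Real.exp (-s) := by rw [hz, mul_assoc, ← Real.exp_add]; congr 2; ring
      _ ≤ _ := by linarith
  have T2 : ((Z:ℝ)+1)^(2*r+1)/D ≤ f := by
    calc ((Z:ℝ)+1)^(2*r+1)/D ≤ (Real.exp (2*s))^(2*r+1)/D := by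
          have : Real.exp (2*s) = z * z := by rw [hz, ← Real.exp_add]; congr 1; ring
          have : (Z:ℝ)+1 ≤ Real.exp (2*s) := by nlinarith
          gcongr
      _ = Real.exp (((2*r+1:ℕ):ℝ)*(2*s) - L) := by
          rw [← Real.exp_nat_mul, Real.exp_sub, ← hDe]
      _ ≤ Real.exp (-s) := by
          apply Real.exp_le_exp.2; rw [hk]; nlinarith
      _ ≤ f := hsf
  have hE : Eerr Z r D ≤ 5 * f := by unfold Eerr; linarith
  have hE0 : 0 ≤ Eerr Z r D := Eerr_nonneg Z r D (by linarith)
  have hc4 : (L+1) * z⁻¹ ≤ f := by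
    rw [hf, le_inv_comm₀ (by positivity) (by positivity)]
    rw [mul_inv, inv_inv, ← div_eq_inv_mul, le_div_iff₀ (by positivity)]
    rw [mul_comm]; exact c4
  have hZ3 : 3 ≤ Z := by
    have : (3:ℝ) ≤ Z := by linarith
    exact_mod_cast this
  have hG : Real.exp (Real.log (2*D) / Z) ≤ 1 + 4 * f := by
    have x1 : Real.log (2*D) / Z ≤ 2 * f := by
      calc Real.log (2*D) / Z ≤ (L+1) / (z/2) := by gcongr; linarith
        _ = 2 * ((L+1) * z⁻¹) := by field_simp
        _ ≤ _ := by linarith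
    have x0 : 0 ≤ Real.log (2*D) / Z := div_nonneg (Real.log_nonneg (by linarith)) (by positivity)
    have := Real.abs_exp_sub_one_le (x := Real.log (2*D) / Z) (by rw [abs_of_nonneg x0]; linarith)
    rw [abs_of_nonneg x0] at this
    have := le_trans (le_abs_self _) this
    linarith
  refine ⟨Z, r, _, (Real.exp_pos _).le, GH_large D Z hZ3, ?_, ?_⟩
  · refine lt_of_le_of_lt ?_ hZ2
    exact Real.exp_le_exp.2 hαs
  · calc _ ≤ (1 + 4*f) * (1 + 5*f) := by gcongr
      _ ≤ _ := by nlinarith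

lemma small_bd (α D0 : ℝ) (hα : 0 < α) (hα1 : α < 1) (hD0 : 1 ≤ D0) :
    ∃ K : ℝ, 0 < K ∧ ∀ D, 1/2 ≤ D → D ≤ D0 → 
    ∃ (Z r : ℕ) (G : ℝ), 0 ≤ G ∧ GH G D Z ∧ Real.exp ((Real.log D)^α) < Z + 1 ∧
      G * (1 + Eerr Z r D) ≤ 1 + K * (Real.exp ((Real.log D)^α))⁻¹ := by
  set M := Real.exp ((Real.log D0)^α + 1) with hM
  have hl0 : 0 ≤ Real.log D0 := Real.log_nonneg hD0
  have hM1 : 1 ≤ M := by rw [hM]; apply Real.one_le_exp; positivity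
  refine ⟨M * (2*D0*(1 + (2*(M+1)*(1+M) + (M+1)/(1/2)))), by positivity, ?_⟩
  intro D h1 h2
  have hF : Real.exp ((Real.log D)^α) ≤ M := by
    apply Real.exp_le_exp.2
    rcases le_total 1 D with h | h
    · have := Real.rpow_le_rpow (Real.log_nonneg h) (Real.log_le_log (by linarith) h2) hα.le
      linarith
    · have a1 := Real.abs_rpow_le_abs_rpow (Real.log D) α
      have a2 : |Real.log D| ≤ 1 := by
        rw [abs_le]
        have b1 := Real.log_le_log (by norm_num) h1
        rw [one_div, Real.log_inv] at b1
        have b2 := Real.log_two_lt_d9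
        have b3 := Real.log_nonpos (by linarith) h
        constructor <;> linarith
      have a3 := Real.rpow_le_one (abs_nonneg _) a2 hα.le
      have a4 := le_abs_self ((Real.log D)^α)
      have : 0 ≤ (Real.log D0)^α := by positivity
      linarith
  set F := Real.exp ((Real.log D)^α) with hFd
  have hF0 : 0 < F := Real.exp_pos _
  have hZ1 : (⌊F⌋₊ : ℝ) ≤ F := Nat.floor_le hF0.le
  refine ⟨⌊F⌋₊, 0, 2*D, by linarith, GH_small D _, Nat.lt_floor_add_one F, ?_⟩
  set Z := ⌊F⌋₊
  have hlogZ : Real.log Z ≤ M := by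
    have := Real.log_le_self (x := (Z:ℝ)) (by positivity)
    linarith
  have hlogZ0 : 0 ≤ Real.log Z := Real.log_natCast_nonneg Z
  have hE0 : 0 ≤ Eerr Z 0 D := Eerr_nonneg Z 0 D h1
  have hE : Eerr Z 0 D ≤ 2*(M+1)*(1+M) + (M+1)/(1/2) := by
    unfold Eerr
    simp only [mul_zero, zero_add, pow_one, Nat.factorial_one, Nat.cast_one, div_one]
    have hZM : (Z:ℝ) ≤ M := by linarith
    gcongr
  have hMF : 1 ≤ M * F⁻¹ := by
    rw [← div_eq_mul_inv, one_le_div hF0]; exact hF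
  set C := 2*D0*(1 + (2*(M+1)*(1+M) + (M+1)/(1/2)))
  have hC : 2*D*(1 + Eerr Z 0 D) ≤ C := by
    apply mul_le_mul (by linarith) (by linarith) (by linarith) (by linarith)
  have hC0 : 0 ≤ C := le_trans (by positivity) hC
  calc _ ≤ C := hC
    _ ≤ C * (M * F⁻¹) := le_mul_of_one_le_right hC0 hMF
    _ ≤ _ := by linarith

lemma prod_cmp (N Z : ℕ) (F : ℝ) (hF : F < Z + 1) :
    ∏ p ∈ N.primeFactors.filter (fun p => Z < p), (1 + 1/((p:ℝ)-1)) ≤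
      ∏ p ∈ N.primeFactors, Set.mulIndicator {q : ℕ | F < (q : ℝ)}
              (fun q => 1 + 1 / ((q : ℝ) - 1)) p := by
  rw [Finset.prod_filter]
  apply Finset.prod_le_prod
  · intro p hp
    have : (2:ℝ) ≤ p := by exact_mod_cast (Nat.prime_of_mem_primeFactors hp).two_le
    split_ifs
    · have : 0 ≤ 1/((p:ℝ)-1) := div_nonneg zero_le_one (by linarith)
      linarith
    · norm_num
  · intro p hp
    have : (2:ℝ) ≤ p := by exact_mod_cast (Nat.prime_of_mem_primeFactors hp).two_le
    have hn : 0 ≤ 1/((p:ℝ)-1) := div_nonneg zero_le_one (by linarith)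
    by_cases h : F < (p:ℝ)
    · rw [Set.mulIndicator_of_mem (show p ∈ {q : ℕ | F < (q : ℝ)} from h)]
      split_ifs <;> linarith
    · rw [Set.mulIndicator_of_notMem (show p ∉ {q : ℕ | F < (q : ℝ)} from h)]
      rw [if_neg]
      intro h3
      have : (Z:ℝ) + 1 ≤ p := by exact_mod_cast h3
      exact h (by linarith)

/-- **Optimised overlap estimate**: for `0 < ρ < 1/2`,
`λ(𝒜_n ∩ 𝒜_m) ≤ λ(𝒜_n) λ(𝒜_m) (1 + O_ρ(F_ρ(D)⁻¹))
  ∏_{p | nm/gcd(n,m)², p > F_ρ(D)} (1 + 1/(p-1))`. -/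
theorem overlap_estimate_optimised (ρ : ℝ) (hρ : ρ ∈ Set.Ioo (0:ℝ) (1/2)) :
    ∃ K : ℝ, 0 < K ∧ ∀ (ψ : ℕ → ℝ), (∀ n, ψ n ∈ Set.Icc (0:ℝ) (1/2)) →
      ∀ (n m : ℕ), 0 < n → 0 < m → n ≠ m →
      (volume (DSset ψ n ∩ DSset ψ m)).toReal ≤
        (volume (DSset ψ n)).toReal * (volume (DSset ψ m)).toReal *
          (1 + K * (Frho ρ (Dfun ψ n m))⁻¹) *
          ∏ p ∈ (n * m / Nat.gcd n m ^ 2).primeFactors,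
            Set.mulIndicator {q : ℕ | Frho ρ (Dfun ψ n m) < (q : ℝ)}
              (fun q => 1 + 1 / ((q : ℝ) - 1)) p := by
  obtain ⟨hρ0, hρ1⟩ := hρ
  have hev := Real.tendsto_log_atTop.eventually
    (ev_cond (1/2-ρ) (1/2-ρ/2) (by linarith) (by linarith) (by linarith))
  obtain ⟨D1, hD1⟩ := Filter.eventually_atTop.1 hev
  set D0 := max D1 1
  obtain ⟨K1, hK1, hsm⟩ := small_bd (1/2-ρ) D0 (by linarith) (by linarith) (le_max_right _ _)
  refine ⟨29 + K1, by linarith, ?_⟩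
  intro ψ hψ n m hn hm hne
  obtain ⟨hA, hB⟩ := overlap_sym ψ hψ n m hn hm hne
  have hP0 : 0 ≤ ∏ p ∈ (n * m / Nat.gcd n m ^ 2).primeFactors,
            Set.mulIndicator {q : ℕ | Frho ρ (Dfun ψ n m) < (q : ℝ)}
              (fun q => 1 + 1 / ((q : ℝ) - 1)) p := by
    refine le_trans ?_ (prod_cmp _ ⌊Frho ρ (Dfun ψ n m)⌋₊ _ (Nat.lt_floor_add_one _))
    exact prodone_nonneg _ _
  have hFp : 0 < Frho ρ (Dfun ψ n m) := Real.exp_pos _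
  rcases lt_or_ge (Dfun ψ n m) (1/2) with hD | hD
  · refine (hA hD).trans ?_
    positivity
  · have key : ∃ (Z r : ℕ) (G : ℝ), 0 ≤ G ∧ GH G (Dfun ψ n m) Z ∧ Frho ρ (Dfun ψ n m) < Z + 1 ∧
      G * (1 + Eerr Z r (Dfun ψ n m)) ≤ 1 + (29 + K1) * (Frho ρ (Dfun ψ n m))⁻¹ := by
      have hfi : 0 < (Frho ρ (Dfun ψ n m))⁻¹ := by positivity
      rcases le_total (Dfun ψ n m) D0 with h | h
      · obtain ⟨Z, r, G, g1, g2, g3, g4⟩ := hsm _ hD h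
        refine ⟨Z, r, G, g1, g2, g3, g4.trans ?_⟩
        change 1 + K1 * (Frho ρ (Dfun ψ n m))⁻¹ ≤ _
        nlinarith
      · obtain ⟨c1, c2, c3, c4, c5⟩ := hD1 _ ((le_max_left _ _).trans h)
        obtain ⟨Z, r, G, g1, g2, g3, g4⟩ := large_bd (1/2-ρ) (1/2-ρ/2) _ (by linarith) (by linarith)
          ((le_max_right _ _).trans h) c1 c2 c3 c4 c5
        refine ⟨Z, r, G, g1, g2, g3, g4.trans ?_⟩
        change 1 + 29 * (Frho ρ (Dfun ψ n m))⁻¹ ≤ _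
        nlinarith
    obtain ⟨Z, r, G, g1, g2, g3, g4⟩ := key
    refine (hB hD Z r G g1 g2).trans ?_
    have := prod_cmp (n * m / Nat.gcd n m ^ 2) Z _ g3
    have h0 := prodone_nonneg (n * m / Nat.gcd n m ^ 2) Z
    gcongr
end

section
/- Let ψ: ℕ → [0,1/2], and for n ∈ ℕ let 𝒜_n := ⋃_{0 ≤ a ≤ n, gcd(a,n)=1} [a/n − ψ(n)/n, a/n + ψ(n)/n] ∩ [0,1]. For positive integers n ≠ m set D = D(n,m) := max(m·ψ(n), n·ψ(m))/gcd(n,m). Then λ(𝒜_n ∩ 𝒜_m) ≪ λ(𝒜_n)·λ(𝒜_m)·∏_{p | nm/gcd(n,m)², p > D} (1 + 1/p), with an absolute implied constant, where the product is over primes p dividing nm/gcd(n,m)² with p > D. -/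
open MeasureTheory

lemma aux_dsum (F : ℕ → ℕ → ℝ) (N : ℕ) :
    ∑ n ∈ Finset.Icc 1 N, ∑ x ∈ n.divisorsAntidiagonal, F x.1 x.2
      = ∑ m ∈ Finset.Icc 1 N, ∑ d ∈ Finset.Icc 1 (N / m), F d m := by
  rw [Finset.sum_sigma', Finset.sum_sigma']
  refine Finset.sum_nbij' (fun y => ⟨y.2.2, y.2.1⟩) (fun y => ⟨y.2 * y.1, (y.2, y.1)⟩) ?_ ?_ ?_ ?_ ?_
  · rintro ⟨n, d, m⟩ h
    simp only [Finset.mem_sigma, Finset.mem_Icc, Nat.mem_divisorsAntidiagonal] at h ⊢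
    obtain ⟨⟨h1, h2⟩, h3, h4⟩ := h
    have hd : 0 < d := by rcases Nat.eq_zero_or_pos d with h | h; · simp [h] at h3; omega
                          · exact h
    have hm : 0 < m := by rcases Nat.eq_zero_or_pos m with h | h; · simp [h] at h3; omega
                          · exact h
    refine ⟨⟨hm, ?_⟩, hd, ?_⟩
    · nlinarith
    · rw [Nat.le_div_iff_mul_le hm]; omega
  · rintro ⟨m, d⟩ h
    simp only [Finset.mem_sigma, Finset.mem_Icc, Nat.mem_divisorsAntidiagonal] at h ⊢
    obtain ⟨⟨h1, h2⟩, h3, h4⟩ := h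
    rw [Nat.le_div_iff_mul_le (by omega)] at h4
    have : 0 < d * m := Nat.mul_pos (by omega) (by omega)
    exact ⟨⟨this, h4⟩, trivial, by omega⟩
  · rintro ⟨n, d, m⟩ h
    simp only [Finset.mem_sigma, Finset.mem_Icc, Nat.mem_divisorsAntidiagonal] at h ⊢
    obtain ⟨⟨h1, h2⟩, h3, h4⟩ := h
    subst h3; rfl
  · rintro ⟨m, d⟩ h
    rfl
  · rintro ⟨n, d, m⟩ h
    rfl

lemma aux_log_eq (n : ℕ) : Real.log n =
    ∑ x ∈ n.divisorsAntidiagonal, ArithmeticFunction.vonMangoldt x.1 := by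
  rw [Nat.sum_divisorsAntidiagonal (fun i _ => ArithmeticFunction.vonMangoldt i),
    ArithmeticFunction.vonMangoldt_sum]

lemma aux_log_eq' (n : ℕ) : Real.log n =
    ∑ x ∈ n.divisorsAntidiagonal, ArithmeticFunction.vonMangoldt x.2 := by
  rw [Nat.sum_divisorsAntidiagonal' (fun _ i => ArithmeticFunction.vonMangoldt i),
    ArithmeticFunction.vonMangoldt_sum]

lemma aux_psi (n : ℕ) : ∑ d ∈ Finset.Icc 1 n, ArithmeticFunction.vonMangoldt d ≤ 6 * (n : ℝ) := by
  have h := Chebyshev.psi_le_const_mul_self (x := (n:ℝ)) (by positivity)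
  have h2 : Real.log 4 ≤ 2 := by
    have : (4:ℝ) = 2 ^ 2 := by norm_num
    rw [this, Real.log_pow]
    have := Real.log_two_lt_d9
    push_cast; linarith
  have h3 : Chebyshev.psi (n:ℝ) = ∑ d ∈ Finset.Icc 1 n, ArithmeticFunction.vonMangoldt d := by
    unfold Chebyshev.psi
    simp only [Nat.floor_natCast]
    rfl
  rw [← h3]
  have : (0:ℝ) ≤ n := by positivity
  nlinarith

lemma aux_mertens1 (N : ℕ) (hN : 1 ≤ N) :
    ∑ d ∈ Finset.Icc 1 N, ArithmeticFunction.vonMangoldt d / (d:ℝ) ≤ Real.log N + 6 := by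
  have hN' : (0:ℝ) < N := by exact_mod_cast hN
  have h1 : ∑ n ∈ Finset.Icc 1 N, Real.log n ≤ N * Real.log N := by
    calc _ ≤ ∑ n ∈ Finset.Icc 1 N, Real.log N := by
          apply Finset.sum_le_sum
          intro i hi
          rw [Finset.mem_Icc] at hi
          apply Real.log_le_log
          · exact_mod_cast hi.1
          · exact_mod_cast hi.2
      _ = _ := by simp
  have h2 : ∑ n ∈ Finset.Icc 1 N, Real.log n
      = ∑ m ∈ Finset.Icc 1 N, ArithmeticFunction.vonMangoldt m * ((N / m : ℕ) : ℝ) := by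
    simp_rw [aux_log_eq']
    rw [aux_dsum (fun _ m => ArithmeticFunction.vonMangoldt m)]
    apply Finset.sum_congr rfl
    intro m _
    simp [mul_comm]
  have h3 : ∑ m ∈ Finset.Icc 1 N, ArithmeticFunction.vonMangoldt m * ((N:ℝ)/m - 1) ≤
      ∑ m ∈ Finset.Icc 1 N, ArithmeticFunction.vonMangoldt m * ((N / m : ℕ) : ℝ) := by
    apply Finset.sum_le_sum
    intro m hm
    apply mul_le_mul_of_nonneg_left _ ArithmeticFunction.vonMangoldt_nonneg
    have := Nat.lt_floor_add_one ((N:ℝ)/m)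
    rw [Nat.floor_div_eq_div] at this
    linarith
  have h4 := aux_psi N
  have h5 : ∑ m ∈ Finset.Icc 1 N, ArithmeticFunction.vonMangoldt m * ((N:ℝ)/m - 1)
      = N * (∑ d ∈ Finset.Icc 1 N, ArithmeticFunction.vonMangoldt d / (d:ℝ)) -
        ∑ m ∈ Finset.Icc 1 N, ArithmeticFunction.vonMangoldt m := by
    rw [Finset.mul_sum, ← Finset.sum_sub_distrib]
    apply Finset.sum_congr rfl
    intro m _
    ring
  have h6 : N * (∑ d ∈ Finset.Icc 1 N, ArithmeticFunction.vonMangoldt d / (d:ℝ)) ≤ N * (Real.log N + 6) := by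
    linarith
  exact le_of_mul_le_mul_left h6 hN'

lemma aux_mertens1p (N : ℕ) (hN : 1 ≤ N) :
    ∑ p ∈ (Finset.Icc 1 N).filter Nat.Prime, Real.log p / (p:ℝ) ≤ Real.log N + 6 := by
  refine le_trans ?_ (aux_mertens1 N hN)
  calc _ = ∑ p ∈ (Finset.Icc 1 N).filter Nat.Prime, ArithmeticFunction.vonMangoldt p / (p:ℝ) := by
        apply Finset.sum_congr rfl
        intro p hp
        rw [ArithmeticFunction.vonMangoldt_apply_prime (Finset.mem_filter.1 hp).2]
    _ ≤ _ := by
        apply Finset.sum_le_sum_of_subset_of_nonneg (Finset.filter_subset _ _)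
        intro i _ _
        exact div_nonneg ArithmeticFunction.vonMangoldt_nonneg (by positivity)

lemma aux_zeta : ∃ δ : ℝ, 0 < δ ∧ ∀ e : ℝ, 0 < e → e < δ →
    ∑' n : ℕ, 1 / (n:ℝ) ^ (1 + e) ≤ 2 / e := by
  have h := tendsto_sub_mul_tsum_nat_rpow.eventually (gt_mem_nhds (show (1:ℝ) < 2 by norm_num))
  rw [eventually_nhdsWithin_iff, Metric.eventually_nhds_iff] at h
  obtain ⟨δ, hδ, h⟩ := h
  refine ⟨δ, hδ, fun e he hed => ?_⟩
  have := @h (1 + e) (by simp [abs_of_pos he, hed]) (by simp [he])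
  rw [le_div_iff₀ he]
  have h2 : (1 + e - 1) = e := by ring
  rw [h2] at this
  linarith

lemma aux_prime_ratio (p : ℕ) (hp : 2 ≤ p) (e : ℝ) (he : 0 < e) :
    (1 - 1 / (p:ℝ))⁻¹ ≤ (1 - (p:ℝ) ^ (-(1 + e)))⁻¹ * Real.exp (2 * e * (Real.log p / p)) := by
  have hp' : (2:ℝ) ≤ p := by exact_mod_cast hp
  have hp0 : (0:ℝ) < p := by linarith
  have hl : 0 ≤ Real.log p := Real.log_nonneg (by linarith)
  have h1 : (p:ℝ) ^ (-(1 + e)) < 1 := Real.rpow_lt_one_of_one_lt_of_neg (by linarith) (by linarith)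
  have h2 : 1 / (p:ℝ) ≤ 1 / 2 := one_div_le_one_div_of_le (by norm_num) hp'
  have h3 : 1 / (p:ℝ) * (1 - e * Real.log p) ≤ (p:ℝ) ^ (-(1 + e)) := by
    rw [neg_add, Real.rpow_add hp0, Real.rpow_neg_one, one_div]
    apply mul_le_mul_of_nonneg_left _ (by positivity)
    rw [Real.rpow_def_of_pos hp0]
    have := Real.add_one_le_exp (Real.log p * -e)
    linarith
  have h4 := Real.add_one_le_exp (2 * e * (Real.log p / p))
  have h5 : 0 ≤ e * (Real.log p / p) := by positivity
  have h6 : e * (Real.log p / p) = 1 / (p:ℝ) * (e * Real.log p) := by ring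
  rw [inv_mul_eq_div, le_div_iff₀ (by linarith), inv_mul_le_iff₀ (by linarith)]
  calc 1 - (p:ℝ) ^ (-(1 + e)) ≤ (1 - 1 / (p:ℝ)) * (2 * e * (Real.log p / p) + 1) := by
        nlinarith
    _ ≤ _ := mul_le_mul_of_nonneg_left h4 (by linarith)

noncomputable def auxHom (e : ℝ) (_he : 0 < e) : ℕ →* ℝ where
  toFun n := (n:ℝ) ^ (-(1 + e))
  map_one' := by simp
  map_mul' a b := by
    push_cast
    rw [Real.mul_rpow (by positivity) (by positivity)]

lemma aux_mertens : ∃ C : ℝ, 0 < C ∧ ∀ N : ℕ, 1 ≤ N →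
    ∏ p ∈ (Finset.Icc 1 N).filter Nat.Prime, (1 - 1 / (p:ℝ))⁻¹ ≤ C * (1 + Real.log N) := by
  obtain ⟨δ, hδ, hz⟩ := aux_zeta
  refine ⟨(2 * (2 / δ + 1)) * Real.exp 12, by positivity, fun N hN => ?_⟩
  have hlog : 0 ≤ Real.log N := Real.log_natCast_nonneg N
  set e := min (δ / 2) (1 / (1 + Real.log N)) with he_def
  have he : 0 < e := lt_min (by positivity) (by positivity)
  have he1 : e < δ := lt_of_le_of_lt (min_le_left _ _) (by linarith)
  have he2 : e * (1 + Real.log N) ≤ 1 := by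
    have := min_le_right (δ / 2) (1 / (1 + Real.log N))
    rwa [← he_def, le_div_iff₀ (by positivity)] at this
  have he3 : 1 / e ≤ (2 / δ + 1) * (1 + Real.log N) := by
    have a1 : 0 < 2 / δ := by positivity
    rcases min_choice (δ / 2) (1 / (1 + Real.log N)) with h | h
    · rw [he_def, h, one_div_div]
      nlinarith
    · rw [he_def, h, one_div_one_div]
      nlinarith
  have hsum : Summable (auxHom e he) := by
    show Summable (fun n : ℕ => (n:ℝ) ^ (-(1 + e)))
    rw [Real.summable_nat_rpow]; linarith
  have h1 : ∏ p ∈ (Finset.Icc 1 N).filter Nat.Prime, (1 - (p:ℝ) ^ (-(1 + e)))⁻¹ ≤ 2 / e := by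
    refine le_trans ?_ (hz e he he1)
    have := EulerProduct.prod_filter_prime_geometric_eq_tsum_factoredNumbers hsum (Finset.Icc 1 N)
    have h2 : ∏ p ∈ (Finset.Icc 1 N).filter Nat.Prime, (1 - (p:ℝ) ^ (-(1 + e)))⁻¹ =
      ∑' m : Nat.factoredNumbers (Finset.Icc 1 N), auxHom e he m := this
    rw [h2]
    have h3 := hsum.tsum_subtype_le (auxHom e he) (Nat.factoredNumbers (Finset.Icc 1 N))
      (fun n => by show (0:ℝ) ≤ (n:ℝ) ^ (-(1 + e)); positivity)
    refine h3.trans (le_of_eq ?_)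
    apply tsum_congr
    intro n
    show (n:ℝ) ^ (-(1 + e)) = _
    rw [Real.rpow_neg (by positivity), one_div]
  have h2 : ∏ p ∈ (Finset.Icc 1 N).filter Nat.Prime, Real.exp (2 * e * (Real.log p / p))
      ≤ Real.exp 12 := by
    rw [← Real.exp_sum, ← Finset.mul_sum]
    apply Real.exp_le_exp.2
    have := aux_mertens1p N hN
    nlinarith
  calc _ ≤ ∏ p ∈ (Finset.Icc 1 N).filter Nat.Prime,
        ((1 - (p:ℝ) ^ (-(1 + e)))⁻¹ * Real.exp (2 * e * (Real.log p / p))) := by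
        apply Finset.prod_le_prod
        · intro p hp
          have hp2 : (1:ℝ) ≤ p := by exact_mod_cast (Finset.mem_filter.1 hp).2.one_le
          have : 1 / (p:ℝ) ≤ 1 := by rw [div_le_one (by linarith)]; exact hp2
          exact inv_nonneg.2 (by linarith)
        · intro p hp
          exact aux_prime_ratio p (Finset.mem_filter.1 hp).2.two_le e he
    _ ≤ (2 / e) * Real.exp 12 := by
        rw [Finset.prod_mul_distrib]
        apply mul_le_mul h1 h2 (Finset.prod_nonneg fun _ _ => (Real.exp_pos _).le) (by positivity)
    _ ≤ _ := by
        have : 2 / e = 2 * (1 / e) := by ring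
        rw [this]
        have h0 := Real.exp_pos 12
        nlinarith [mul_le_mul_of_nonneg_right he3 h0.le]

lemma aux_tele (N : ℕ) (hN : 1 ≤ N) :
    ∑ k ∈ Finset.Icc 1 N, 1 / ((k:ℝ) * (k - 1)) = 1 - 1 / N := by
  induction N, hN using Nat.le_induction with
  | base => simp
  | succ n hn ih =>
    rw [Finset.sum_Icc_succ_top (by omega), ih]
    have : (n:ℝ) ≠ 0 := by positivity
    have h2 : (n:ℝ) + 1 ≠ 0 := by positivity
    push_cast
    rw [add_sub_cancel_right]
    field_simp
    ring

lemma aux_tele_le (s : Finset ℕ) (hs : ∀ p ∈ s, 1 ≤ p) :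
    ∑ k ∈ s, 1 / ((k:ℝ) * (k - 1)) ≤ 1 := by
  have h1 : s ⊆ Finset.Icc 1 (s.sup id + 1) := by
    intro p hp
    rw [Finset.mem_Icc]
    exact ⟨hs p hp, (Finset.le_sup (f := id) hp).trans (Nat.le_succ _)⟩
  refine (Finset.sum_le_sum_of_subset_of_nonneg h1 ?_).trans ?_
  · intro i hi _
    have : (1:ℝ) ≤ i := by exact_mod_cast (Finset.mem_Icc.1 hi).1
    apply div_nonneg zero_le_one
    apply mul_nonneg <;> linarith
  · rw [aux_tele _ (by omega)]
    have : (0:ℝ) ≤ 1 / ((s.sup id + 1 : ℕ) : ℝ) := by positivity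
    linarith

lemma aux_euler_factor (p : ℕ) (hp : p.Prime) :
    HasSum (fun n : ℕ => 1 / ((p ^ n).totient : ℝ)) (1 + (1 / ((p:ℝ) - 1)) * (1 - 1 / (p:ℝ))⁻¹) := by
  have hp2 : (2:ℝ) ≤ p := by exact_mod_cast hp.two_le
  rw [← hasSum_nat_add_iff' 1]
  have h1 := hasSum_geometric_of_lt_one (r := 1 / (p:ℝ)) (by positivity)
    (by rw [div_lt_one (by linarith)]; linarith)
  convert h1.mul_left (1 / ((p:ℝ) - 1)) using 1
  · rfl
  · ext n
    rw [Nat.totient_prime_pow_succ hp]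
    push_cast [Nat.cast_sub hp.one_le]
    rw [one_div_pow]
    field_simp
  · simp

lemma aux_euler_factor_le (p : ℕ) (hp : p.Prime) :
    1 + (1 / ((p:ℝ) - 1)) * (1 - 1 / (p:ℝ))⁻¹ ≤
      (1 - 1 / (p:ℝ))⁻¹ * Real.exp (1 / ((p:ℝ) * (p - 1))) := by
  have hp2 : (2:ℝ) ≤ p := by exact_mod_cast hp.two_le
  have h1 : (1 - 1 / (p:ℝ)) = (p - 1) / p := by field_simp
  have hp1 : (0:ℝ) < p - 1 := by linarith
  have h2 : 0 ≤ (1 - 1 / (p:ℝ))⁻¹ := by rw [h1]; positivity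
  calc 1 + (1 / ((p:ℝ) - 1)) * (1 - 1 / (p:ℝ))⁻¹
      = (1 - 1 / (p:ℝ))⁻¹ * (1 / ((p:ℝ) * (p - 1)) + 1) := by
        rw [h1]; field_simp; ring
    _ ≤ _ := mul_le_mul_of_nonneg_left (Real.add_one_le_exp _) h2

lemma aux_L (Q N : ℕ) :
    ∑ m ∈ (Finset.Icc 1 N).filter (fun m => Nat.Coprime m Q), 1 / (m.totient : ℝ) ≤
      Real.exp 1 * ∏ p ∈ (Finset.Icc 1 N).filter (fun p => p.Prime ∧ ¬ p ∣ Q), (1 - 1 / (p:ℝ))⁻¹ := by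
  set s := (Finset.Icc 1 N).filter (fun p => ¬ p ∣ Q) with hs
  have hE := EulerProduct.summable_and_hasSum_factoredNumbers_prod_filter_prime_tsum
    (f := fun n : ℕ => 1 / (n.totient : ℝ)) (by simp)
    (fun {m n} h => by rw [Nat.totient_mul h]; push_cast; field_simp)
    (fun {p} hp => by simpa using (aux_euler_factor p hp).summable) s
  have hS : s.filter Nat.Prime = (Finset.Icc 1 N).filter (fun p => p.Prime ∧ ¬ p ∣ Q) := by
    rw [hs, Finset.filter_filter]
    apply Finset.filter_congr
    intro x _
    tauto
  rw [hS] at hE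
  have h1 : ∑ m ∈ (Finset.Icc 1 N).filter (fun m => Nat.Coprime m Q), 1 / (m.totient : ℝ) ≤
      ∏ p ∈ (Finset.Icc 1 N).filter (fun p => p.Prime ∧ ¬ p ∣ Q), ∑' n : ℕ, 1 / ((p ^ n).totient : ℝ) := by
    rw [← hE.2.tsum_eq]
    have hmem : ∀ m ∈ (Finset.Icc 1 N).filter (fun m => Nat.Coprime m Q),
        m ∈ Nat.factoredNumbers s := by
      intro m hm
      rw [Finset.mem_filter, Finset.mem_Icc] at hm
      obtain ⟨⟨h1, h2⟩, h3⟩ := hm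
      rw [Nat.mem_factoredNumbers']
      intro p hp hpm
      rw [hs, Finset.mem_filter, Finset.mem_Icc]
      refine ⟨⟨hp.one_le, (Nat.le_of_dvd h1 hpm).trans h2⟩, fun hq => ?_⟩
      exact Nat.Prime.one_lt hp |>.ne' (Nat.dvd_one.1 (h3 ▸ Nat.dvd_gcd hpm hq))
    rw [← Finset.sum_attach]
    let emb : {x // x ∈ (Finset.Icc 1 N).filter (fun m => Nat.Coprime m Q)} ↪ Nat.factoredNumbers s :=
      ⟨fun m => ⟨m.1, hmem m.1 m.2⟩, fun a b h =>
          Subtype.ext (congrArg (fun z : Nat.factoredNumbers s => (z:ℕ)) h)⟩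
    have := hE.2.summable.sum_le_tsum
      (((Finset.Icc 1 N).filter (fun m => Nat.Coprime m Q)).attach.map emb)
      (fun i _ => by positivity)
    rw [Finset.sum_map] at this
    exact this
  refine h1.trans ?_
  calc _ ≤ ∏ p ∈ (Finset.Icc 1 N).filter (fun p => p.Prime ∧ ¬ p ∣ Q),
        ((1 - 1 / (p:ℝ))⁻¹ * Real.exp (1 / ((p:ℝ) * (p - 1)))) := by
        apply Finset.prod_le_prod
        · intro i _
          exact tsum_nonneg fun _ => by positivity
        · intro p hp
          have hp' := (Finset.mem_filter.1 hp).2.1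
          rw [(aux_euler_factor p hp').tsum_eq]
          exact aux_euler_factor_le p hp'
    _ ≤ _ := by
        rw [Finset.prod_mul_distrib, mul_comm]
        apply mul_le_mul_of_nonneg_right
        · rw [← Real.exp_sum]
          apply Real.exp_le_exp.2
          apply aux_tele_le
          intro p hp
          exact (Finset.mem_filter.1 hp).2.1.one_le
        · apply Finset.prod_nonneg
          intro p hp
          have hp2 : (1:ℝ) ≤ p := by exact_mod_cast (Finset.mem_filter.1 hp).2.1.one_le
          have : 1 / (p:ℝ) ≤ 1 := by rw [div_le_one (by linarith)]; exact hp2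
          exact inv_nonneg.2 (by linarith)

lemma aux_L2 : ∃ C : ℝ, 0 < C ∧ ∀ Q N : ℕ, 1 ≤ N →
    ∑ m ∈ (Finset.Icc 1 N).filter (fun m => Nat.Coprime m Q), 1 / (m.totient : ℝ) ≤
      C * (1 + Real.log N) *
        ∏ p ∈ (Finset.Icc 1 N).filter (fun p => p.Prime ∧ p ∣ Q), (1 - 1 / (p:ℝ)) := by
  obtain ⟨C, hC, h⟩ := aux_mertens
  refine ⟨Real.exp 1 * C, by positivity, fun Q N hN => ?_⟩
  refine (aux_L Q N).trans ?_
  rw [mul_assoc, mul_assoc]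
  apply mul_le_mul_of_nonneg_left _ (Real.exp_pos 1).le
  rw [← mul_assoc]
  have hpos : ∀ p : ℕ, p.Prime → 0 < (1 - 1 / (p:ℝ)) := by
    intro p hp
    have hp2 : (1:ℝ) < p := by exact_mod_cast hp.one_lt
    have : 1 / (p:ℝ) < 1 := by rw [div_lt_one (by linarith)]; exact hp2
    linarith
  have hP : 0 < ∏ p ∈ (Finset.Icc 1 N).filter (fun p => p.Prime ∧ p ∣ Q), (1 - 1 / (p:ℝ)) :=
    Finset.prod_pos fun p hp => hpos p (Finset.mem_filter.1 hp).2.1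
  rw [← div_le_iff₀ hP]
  refine le_trans (le_of_eq ?_) (h N hN)
  rw [div_eq_mul_inv, ← Finset.prod_inv_distrib, mul_comm]
  rw [← Finset.prod_filter_mul_prod_filter_not ((Finset.Icc 1 N).filter Nat.Prime) (fun p => p ∣ Q),
    Finset.filter_filter, Finset.filter_filter]

lemma aux_submul (d m Q : ℕ) (hd : 1 ≤ d) (hm : 1 ≤ m) :
    ArithmeticFunction.vonMangoldt d *
      (if Nat.Coprime (d * m) Q then ((d * m : ℕ) : ℝ) / (d * m).totient else 0) ≤
    2 * ArithmeticFunction.vonMangoldt d *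
      (if Nat.Coprime m Q then (m : ℝ) / m.totient else 0) := by
  have hL : 0 ≤ ArithmeticFunction.vonMangoldt d := ArithmeticFunction.vonMangoldt_nonneg
  by_cases hpp : IsPrimePow d
  swap
  · rw [ArithmeticFunction.vonMangoldt_eq_zero_iff.2 hpp]; simp
  split_ifs with h1 h2 h2
  · rw [mul_comm 2, mul_assoc]
    apply mul_le_mul_of_nonneg_left _ hL
    have t1 : (0:ℝ) < d.totient := by exact_mod_cast Nat.totient_pos.2 hd
    have t2 : (0:ℝ) < m.totient := by exact_mod_cast Nat.totient_pos.2 hm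
    have h3 : (d.totient : ℝ) * m.totient ≤ (d * m).totient := by
      exact_mod_cast Nat.totient_super_multiplicative d m
    have h4 : (d:ℝ) ≤ 2 * d.totient := by
      obtain ⟨p, k, hp, hk, rfl⟩ := hpp
      rw [← Nat.prime_iff] at hp
      rw [Nat.totient_prime_pow hp hk]
      obtain ⟨k, rfl⟩ := Nat.exists_eq_succ_of_ne_zero hk.ne'
      push_cast [Nat.cast_sub hp.one_le]
      have hp2 : (2:ℝ) ≤ p := by exact_mod_cast hp.two_le
      simp only [Nat.succ_eq_add_one, pow_succ]
      have : (0:ℝ) ≤ (p:ℝ) ^ k := by positivity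
      nlinarith
    calc ((d * m : ℕ) : ℝ) / (d * m).totient ≤ ((d * m : ℕ) : ℝ) / ((d.totient : ℝ) * m.totient) := by
          apply div_le_div_of_nonneg_left (by positivity) (by positivity) h3
      _ = (d / d.totient) * (m / m.totient) := by push_cast; field_simp
      _ ≤ _ := by
          apply mul_le_mul_of_nonneg_right _ (by positivity)
          rw [div_le_iff₀ t1]; exact h4
  · exact absurd (Nat.Coprime.coprime_mul_left h1) h2
  · rw [mul_zero]; positivity
  · simp

lemma aux_HT (Q N : ℕ) (hN : 1 ≤ N) :
    (∑ k ∈ (Finset.Icc 1 N).filter (fun m => Nat.Coprime m Q), (k:ℝ) / k.totient) * Real.log N ≤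
     13 * N * ∑ m ∈ (Finset.Icc 1 N).filter (fun m => Nat.Coprime m Q), 1 / (m.totient : ℝ) := by
  set f : ℕ → ℝ := fun k => if Nat.Coprime k Q then (k:ℝ) / k.totient else 0 with hf
  have hf0 : ∀ k, 0 ≤ f k := by
    intro k; simp only [hf]; split_ifs <;> positivity
  have hN' : (0:ℝ) < N := by exact_mod_cast hN
  have hL : ∑ m ∈ (Finset.Icc 1 N).filter (fun m => Nat.Coprime m Q), 1 / (m.totient : ℝ) =
      ∑ m ∈ Finset.Icc 1 N, f m / m := by
    rw [Finset.sum_filter]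
    apply Finset.sum_congr rfl
    intro m hm
    have : (m:ℝ) ≠ 0 := by
      have := (Finset.mem_Icc.1 hm).1
      positivity
    simp only [hf]
    split_ifs
    · field_simp
    · simp
  have hS : ∑ k ∈ (Finset.Icc 1 N).filter (fun m => Nat.Coprime m Q), (k:ℝ) / k.totient =
      ∑ m ∈ Finset.Icc 1 N, f m := by
    rw [Finset.sum_filter]
  rw [hL, hS]
  have h1 : ∑ m ∈ Finset.Icc 1 N, f m * Real.log m ≤ 12 * N * ∑ m ∈ Finset.Icc 1 N, f m / m := by
    calc ∑ m ∈ Finset.Icc 1 N, f m * Real.log m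
        = ∑ n ∈ Finset.Icc 1 N, ∑ x ∈ n.divisorsAntidiagonal,
            ArithmeticFunction.vonMangoldt x.1 * f (x.1 * x.2) := by
          apply Finset.sum_congr rfl
          intro n _
          rw [aux_log_eq, Finset.mul_sum]
          apply Finset.sum_congr rfl
          intro x hx
          rw [(Nat.mem_divisorsAntidiagonal.1 hx).1, mul_comm]
      _ = ∑ m ∈ Finset.Icc 1 N, ∑ d ∈ Finset.Icc 1 (N / m),
            ArithmeticFunction.vonMangoldt d * f (d * m) :=
          aux_dsum (fun d m => ArithmeticFunction.vonMangoldt d * f (d * m)) N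
      _ ≤ ∑ m ∈ Finset.Icc 1 N, ∑ d ∈ Finset.Icc 1 (N / m),
            2 * ArithmeticFunction.vonMangoldt d * f m := by
          apply Finset.sum_le_sum
          intro m hm
          apply Finset.sum_le_sum
          intro d hd
          exact aux_submul d m Q (Finset.mem_Icc.1 hd).1 (Finset.mem_Icc.1 hm).1
      _ ≤ ∑ m ∈ Finset.Icc 1 N, 12 * N * (f m / m) := by
          apply Finset.sum_le_sum
          intro m hm
          rw [← Finset.sum_mul, ← Finset.mul_sum]
          have a1 := aux_psi (N / m)
          have a2 : ((N / m : ℕ) : ℝ) ≤ (N:ℝ) / m := Nat.cast_div_le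
          calc _ ≤ 2 * (6 * ((N:ℝ) / m)) * f m := by
                apply mul_le_mul_of_nonneg_right _ (hf0 m)
                linarith
            _ = _ := by ring
      _ = _ := by rw [Finset.mul_sum]
  have h2 : (∑ m ∈ Finset.Icc 1 N, f m) * Real.log N ≤
      ∑ m ∈ Finset.Icc 1 N, f m * Real.log m + N * ∑ m ∈ Finset.Icc 1 N, f m / m := by
    rw [Finset.sum_mul, Finset.mul_sum, ← Finset.sum_add_distrib]
    apply Finset.sum_le_sum
    intro m hm
    have hm' : (0:ℝ) < m := by exact_mod_cast (Finset.mem_Icc.1 hm).1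
    have a1 : Real.log N - Real.log m ≤ N / m := by
      rw [← Real.log_div hN'.ne' hm'.ne']
      exact (Real.log_le_sub_one_of_pos (by positivity)).trans (by linarith)
    calc f m * Real.log N = f m * Real.log m + f m * (Real.log N - Real.log m) := by ring
      _ ≤ f m * Real.log m + f m * (N / m) := by
          gcongr
      _ = _ := by ring
  linarith

lemma aux_sieve : ∃ C : ℝ, 0 < C ∧ ∀ Q N : ℕ, 1 ≤ N →
    ∑ k ∈ (Finset.Icc 1 N).filter (fun m => Nat.Coprime m Q), (k:ℝ) / k.totient ≤
      C * N * ∏ p ∈ (Finset.Icc 1 N).filter (fun p => p.Prime ∧ p ∣ Q), (1 - 1 / (p:ℝ)) := by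
  obtain ⟨C, hC, h⟩ := aux_L2
  refine ⟨13 * C * 3 + 1, by positivity, fun Q N hN => ?_⟩
  rcases eq_or_lt_of_le hN with h1 | h1
  · subst h1
    have e1 : (Finset.Icc 1 1).filter (fun p => p.Prime ∧ p ∣ Q) = ∅ := by
      rw [Finset.filter_eq_empty_iff]
      intro p hp hp2
      simp at hp
      subst hp
      exact Nat.not_prime_one hp2.1
    rw [e1]
    simp [Finset.filter_singleton]
    positivity
  · have hl : 1 / 2 ≤ Real.log N := by
      have : Real.log 2 ≤ Real.log N := Real.log_le_log (by norm_num) (by exact_mod_cast h1)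
      have := Real.log_two_gt_d9
      linarith
    have a1 := aux_HT Q N hN
    have a2 := h Q N hN
    set P := ∏ p ∈ (Finset.Icc 1 N).filter (fun p => p.Prime ∧ p ∣ Q), (1 - 1 / (p:ℝ)) with hPdef
    have hP : 0 ≤ P := by
      apply Finset.prod_nonneg
      intro p hp
      have hp2 : (1:ℝ) ≤ p := by exact_mod_cast (Finset.mem_filter.1 hp).2.1.one_le
      have : 1 / (p:ℝ) ≤ 1 := by rw [div_le_one (by linarith)]; exact hp2
      linarith
    have hlp : 0 < Real.log N := by linarith
    refine le_of_mul_le_mul_right (a1.trans ?_) hlp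
    have hNN : (0:ℝ) ≤ N := by positivity
    calc 13 * (N:ℝ) * _ ≤ 13 * N * (C * (1 + Real.log N) * P) := by gcongr
      _ ≤ 13 * N * (C * (3 * Real.log N) * P) := by gcongr; linarith
      _ ≤ _ := by
        have : 0 ≤ N * P * Real.log N := by positivity
        nlinarith

lemma aux_crt (S : Finset ℕ) (hS : ∀ p ∈ S, p.Prime) (h : ℕ) (G : ℕ → Finset ℤ) (c : ℤ) :
    ((Finset.Ico c (c + (h * ∏ p ∈ S, p : ℕ))).filter (fun j => ∀ p ∈ S, j % (p:ℤ) ∈ G p)).card ≤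
      h * ∏ p ∈ S, (G p).card := by
  set R := ∏ p ∈ S, p with hR
  have hR0 : 0 < R := Finset.prod_pos fun p hp => (hS p hp).pos
  rw [← Finset.card_pi, mul_comm h]
  rw [mul_comm]
  refine Finset.card_le_mul_card_image_of_maps_to
    (f := fun (j:ℤ) (p:ℕ) (_ : p ∈ S) => j % (p:ℤ)) ?_ h ?_
  · intro j hj
    simp only [Finset.mem_filter] at hj
    simp only [Finset.mem_pi]
    intro p hp
    exact hj.2 p hp
  · intro x _
    rcases Finset.eq_empty_or_nonempty
      (((Finset.Ico c (c + (h * R : ℕ))).filter (fun j => ∀ p ∈ S, j % (p:ℤ) ∈ G p)).filter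
        (fun j => (fun (p:ℕ) (_ : p ∈ S) => j % (p:ℤ)) = x)) with h0 | ⟨j0, hj0⟩
    · rw [h0]; simp
    · have hj0' := (Finset.mem_filter.1 hj0).2
      calc _ ≤ ((Finset.Ico c (c + (h * R : ℕ))).filter (fun j => j ≡ j0 [ZMOD R])).card := by
            apply Finset.card_le_card
            intro j hj
            rw [Finset.mem_filter, Finset.mem_filter] at hj
            rw [Finset.mem_filter]
            refine ⟨hj.1.1, ?_⟩
            have h2 : ∀ p ∈ S, (p:ℤ) ∣ j0 - j := by
              intro p hp
              have e1 := congrFun (congrFun (hj.2.trans hj0'.symm) p) hp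
              exact Int.ModEq.dvd e1
            rw [Int.modEq_iff_dvd, hR]
            push_cast
            apply Finset.prod_dvd_of_coprime
            · intro p hp q hq hpq
              exact Nat.isCoprime_iff_coprime.2 ((Nat.coprime_primes (hS p hp) (hS q hq)).2 hpq)
            · exact h2
        _ = h := by
            have := Int.Ico_filter_modEq_card (a := c) (b := c + (h * R : ℕ)) (r := R)
              (by exact_mod_cast hR0) j0
            have e2 : ((((c + (h * R : ℕ) : ℤ)) : ℚ) - j0) / ((R:ℤ):ℚ) = (c - j0) / ((R:ℤ):ℚ) + (h:ℤ) := by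
              have : (R:ℚ) ≠ 0 := by positivity
              push_cast
              field_simp
              ring
            rw [e2, Int.ceil_add_intCast] at this
            simp at this
            exact_mod_cast this
        _ ≤ h := le_rfl

lemma aux_res (p : ℕ) (hp : p.Prime) (n a : ℤ) (h : ¬ (p:ℤ) ∣ n) :
    ∃ r ∈ Finset.Ico (0:ℤ) p, (p:ℤ) ∣ a + r * n := by
  have hp0 : (0:ℤ) < p := by exact_mod_cast hp.pos
  have hc : IsCoprime (p:ℤ) n := (Nat.prime_iff_prime_int.1 hp).coprime_iff_not_dvd.2 h
  obtain ⟨u, v, huv⟩ := hc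
  refine ⟨(-a * v) % p, ?_, ?_⟩
  · rw [Finset.mem_Ico]
    exact ⟨Int.emod_nonneg _ hp0.ne', Int.emod_lt_of_pos _ hp0⟩
  · rw [Int.emod_def]
    refine ⟨a * u - (-a * v / p) * n, ?_⟩
    linear_combination (-a) * huv

lemma aux_G (p : ℕ) (hp : p.Prime) (n m a b : ℤ) (hnm : IsCoprime n m) :
    (((Finset.Ico (0:ℤ) p).filter
      (fun r => ¬ (p:ℤ) ∣ a + r * n ∧ ¬ (p:ℤ) ∣ b + r * m)).card : ℝ) ≤
    p * ((1 - 1 / (p:ℝ)) * (if (p:ℤ) ∣ n * m ∨ (p:ℤ) ∣ a * m - b * n then 1 else (1 - 1 / (p:ℝ)))) := by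
  have hp2 : (2:ℝ) ≤ p := by exact_mod_cast hp.two_le
  have hpp := Nat.prime_iff_prime_int.1 hp
  have hcard : (Finset.Ico (0:ℤ) p).card = p := by simp
  by_cases hcase : (p:ℤ) ∣ n * m ∨ (p:ℤ) ∣ a * m - b * n
  · rw [if_pos hcase, mul_one]
    have : ∃ r ∈ Finset.Ico (0:ℤ) p, (p:ℤ) ∣ a + r * n ∨ (p:ℤ) ∣ b + r * m := by
      by_cases hn : (p:ℤ) ∣ n
      · have hm : ¬ (p:ℤ) ∣ m := fun hm => hpp.not_isUnit (hnm.isUnit_of_dvd' hn hm)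
        obtain ⟨r, hr, h⟩ := aux_res p hp m b hm
        exact ⟨r, hr, Or.inr h⟩
      · obtain ⟨r, hr, h⟩ := aux_res p hp n a hn
        exact ⟨r, hr, Or.inl h⟩
    obtain ⟨r, hr, h⟩ := this
    have hle : ((Finset.Ico (0:ℤ) p).filter
      (fun r => ¬ (p:ℤ) ∣ a + r * n ∧ ¬ (p:ℤ) ∣ b + r * m)).card ≤ p - 1 := by
      rw [← hcard, ← Finset.card_erase_of_mem hr, hcard]
      apply Finset.card_le_card
      intro x hx
      rw [Finset.mem_filter] at hx
      rw [Finset.mem_erase]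
      refine ⟨?_, hx.1⟩
      rintro rfl
      tauto
    have : (((p - 1 : ℕ)) : ℝ) = p * (1 - 1 / (p:ℝ)) := by
      push_cast [Nat.cast_sub hp.one_le]
      field_simp
    rw [← this]
    exact_mod_cast hle
  · rw [if_neg hcase]
    push Not at hcase
    obtain ⟨h1, h2⟩ := hcase
    have hn : ¬ (p:ℤ) ∣ n := fun h => h1 (h.mul_right _)
    have hm : ¬ (p:ℤ) ∣ m := fun h => h1 (h.mul_left _)
    obtain ⟨r, hr, h⟩ := aux_res p hp n a hn
    obtain ⟨r', hr', h'⟩ := aux_res p hp m b hm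
    have hne : r' ≠ r := by
      rintro rfl
      apply h2
      have := dvd_sub (h.mul_right m) (h'.mul_right n)
      rwa [show (a + r' * n) * m - (b + r' * m) * n = a * m - b * n by ring] at this
    have hle : ((Finset.Ico (0:ℤ) p).filter
      (fun r => ¬ (p:ℤ) ∣ a + r * n ∧ ¬ (p:ℤ) ∣ b + r * m)).card ≤ p - 1 - 1 := by
      have e : (((Finset.Ico (0:ℤ) p).erase r).erase r').card = p - 1 - 1 := by
        rw [Finset.card_erase_of_mem (Finset.mem_erase.2 ⟨hne, hr'⟩), Finset.card_erase_of_mem hr, hcard]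
      rw [← e]
      apply Finset.card_le_card
      intro x hx
      rw [Finset.mem_filter] at hx
      rw [Finset.mem_erase, Finset.mem_erase]
      refine ⟨?_, ?_, hx.1⟩
      · rintro rfl
        tauto
      · rintro rfl
        tauto
    have h3 : (((p - 1 - 1: ℕ)) : ℝ) = p - 2 := by
      have := hp.two_le
      rw [Nat.sub_sub, Nat.cast_sub this]; norm_num
    have h4 : (p:ℝ) * ((1 - 1 / (p:ℝ)) * (1 - 1 / (p:ℝ))) = p - 2 + 1 / p := by
      field_simp
      ring
    have h5 : (0:ℝ) ≤ 1 / p := by positivity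
    rw [h4]
    have : (((Finset.Ico (0:ℤ) p).filter
      (fun r => ¬ (p:ℤ) ∣ a + r * n ∧ ¬ (p:ℤ) ∣ b + r * m)).card : ℝ) ≤ ((p - 1 - 1 : ℕ) : ℝ) := by
      exact_mod_cast hle
    linarith

lemma aux_cpos (p : ℕ) (hp : p.Prime) : 0 < (1 - 1 / (p:ℝ)) := by
  have hp2 : (1:ℝ) < p := by exact_mod_cast hp.one_lt
  have : 1 / (p:ℝ) < 1 := by rw [div_lt_one (by linarith)]; exact hp2
  linarith

lemma aux_totient (n : ℕ) : (n.totient : ℝ) = n * ∏ p ∈ n.primeFactors, (1 - 1 / (p:ℝ)) := by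
  have := Nat.totient_eq_mul_prod_factors n
  have h2 : ((n.totient : ℚ) : ℝ) = ((n * ∏ p ∈ n.primeFactors, (1 - (p:ℚ)⁻¹) : ℚ) : ℝ) := by rw [this]
  push_cast at h2
  simpa [one_div] using h2

lemma aux_Nk (g n m : ℕ) (hg : 0 < g) (hn : 0 < n) (hm : 0 < m) (hnm : Nat.Coprime n m) (k : ℤ)
    (hk : k ≠ 0) (T : Finset (ℕ × ℕ))
    (hT : ∀ x ∈ T, x.1 ≤ g * n ∧ x.2 ≤ g * m ∧ Nat.Coprime x.1 (g * n) ∧ Nat.Coprime x.2 (g * m) ∧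
      (x.1 : ℤ) * m - x.2 * n = k) :
    (T.card : ℝ) ≤ 3 * g * ((∏ p ∈ g.primeFactors, (1 - 1 / (p:ℝ))) *
      ∏ p ∈ g.primeFactors \ (n * m).primeFactors, (1 - 1 / (p:ℝ))) *
      ((k.natAbs : ℝ) / k.natAbs.totient) := by
  have hkk : 0 < k.natAbs := Int.natAbs_pos.2 hk
  have hprod0 : 0 ≤ 3 * (g:ℝ) * ((∏ p ∈ g.primeFactors, (1 - 1 / (p:ℝ))) *
      ∏ p ∈ g.primeFactors \ (n * m).primeFactors, (1 - 1 / (p:ℝ))) := by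
    have h1 : 0 ≤ ∏ p ∈ g.primeFactors, (1 - 1 / (p:ℝ)) :=
      Finset.prod_nonneg fun p hp => (aux_cpos p (Nat.prime_of_mem_primeFactors hp)).le
    have h2 : 0 ≤ ∏ p ∈ g.primeFactors \ (n * m).primeFactors, (1 - 1 / (p:ℝ)) :=
      Finset.prod_nonneg fun p hp =>
        (aux_cpos p (Nat.prime_of_mem_primeFactors (Finset.mem_sdiff.1 hp).1)).le
    positivity
  rcases T.eq_empty_or_nonempty with h0 | ⟨⟨a0, b0⟩, hab⟩
  · rw [h0]
    simp only [Finset.card_empty, Nat.cast_zero]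
    positivity
  obtain ⟨ha1, hb1, ha2, hb2, hk0⟩ := hT _ hab
  simp only at ha1 hb1 ha2 hb2 hk0
  have hnZ : (0:ℤ) < n := by exact_mod_cast hn
  have hmZ : (0:ℤ) < m := by exact_mod_cast hm
  have hcop : IsCoprime (n:ℤ) (m:ℤ) := Nat.isCoprime_iff_coprime.2 hnm
  obtain ⟨h, hh⟩ := Nat.prod_primeFactors_dvd g
  set G : ℕ → Finset ℤ := fun p => (Finset.Ico (0:ℤ) p).filter
      (fun r => ¬ (p:ℤ) ∣ (a0:ℤ) + r * n ∧ ¬ (p:ℤ) ∣ (b0:ℤ) + r * m) with hG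
  have hj : ∀ x ∈ T, ∃ j : ℤ, (x.1:ℤ) = a0 + j * n ∧ (x.2:ℤ) = b0 + j * m := by
    intro x hx
    obtain ⟨-, -, -, -, hkx⟩ := hT x hx
    have h1 : ((x.1:ℤ) - a0) * m = (x.2 - b0) * n := by linear_combination hkx - hk0
    have h2 : (n:ℤ) ∣ (x.1:ℤ) - a0 := by
      apply hcop.dvd_of_dvd_mul_right
      rw [h1]; exact dvd_mul_left _ _
    obtain ⟨j, hj⟩ := h2
    refine ⟨j, by linarith, ?_⟩
    have h3 : (n:ℤ) * ((x.2:ℤ) - b0 - j * m) = 0 := by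
      rw [hj] at h1; linear_combination -h1
    have := (mul_eq_zero.1 h3).resolve_left hnZ.ne'
    linarith
  have hcard : T.card ≤ ((Finset.Ico (-(g:ℤ)) (-(g:ℤ) + ((3 * h) * ∏ p ∈ g.primeFactors, p : ℕ))).filter
      (fun j => ∀ p ∈ g.primeFactors, j % (p:ℤ) ∈ G p)).card := by
    choose! J hJ using hj
    apply Finset.card_le_card_of_injOn J
    · intro x hx
      have hx : x ∈ T := hx
      obtain ⟨hx1, hx2, hx3, hx4, -⟩ := hT x hx
      obtain ⟨e1, e2⟩ := hJ x hx
      rw [Finset.mem_coe, Finset.mem_filter, Finset.mem_Ico]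
      have hx1' : (x.1:ℤ) ≤ g * n := by exact_mod_cast hx1
      have ha1' : (a0:ℤ) ≤ g * n := by exact_mod_cast ha1
      have hgh : (((3 * h) * ∏ p ∈ g.primeFactors, p : ℕ) : ℤ) = 3 * g := by
        have : ((g:ℕ):ℤ) = ((∏ p ∈ g.primeFactors, p : ℕ) : ℤ) * h := by exact_mod_cast hh
        rw [this]; push_cast; ring
      have hgZ : (0:ℤ) < g := by exact_mod_cast hg
      have b1 : -(g:ℤ) ≤ J x := by
        have : -(g:ℤ) * n ≤ J x * n := by nlinarith
        exact le_of_mul_le_mul_right this hnZ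
      have b2 : J x ≤ g := by
        have : J x * n ≤ g * n := by nlinarith
        exact le_of_mul_le_mul_right this hnZ
      refine ⟨⟨b1, by rw [hgh]; linarith⟩, ?_⟩
      intro p hp
      have hpp := Nat.prime_of_mem_primeFactors hp
      have hpg := Nat.dvd_of_mem_primeFactors hp
      have hp0 : (0:ℤ) < p := by exact_mod_cast hpp.pos
      simp only [hG, Finset.mem_filter, Finset.mem_Ico]
      refine ⟨⟨Int.emod_nonneg _ hp0.ne', Int.emod_lt_of_pos _ hp0⟩, ?_, ?_⟩
      · intro hd
        have : (p:ℤ) ∣ x.1 := by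
          rw [e1, ← Int.emod_add_mul_ediv (J x) p]
          have := dvd_add hd (Dvd.intro ((J x / p) * n) rfl : (p:ℤ) ∣ p * ((J x / p) * n))
          rwa [show (a0:ℤ) + J x % p * n + p * (J x / p * n) = a0 + (J x % p + p * (J x / p)) * n by ring] at this
        have h3 : p ∣ x.1 := by exact_mod_cast this
        exact hpp.one_lt.ne' (Nat.dvd_one.1 (hx3 ▸ Nat.dvd_gcd h3 (hpg.mul_right n)))
      · intro hd
        have : (p:ℤ) ∣ x.2 := by
          rw [e2, ← Int.emod_add_mul_ediv (J x) p]
          have := dvd_add hd (Dvd.intro ((J x / p) * m) rfl : (p:ℤ) ∣ p * ((J x / p) * m))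
          rwa [show (b0:ℤ) + J x % p * m + p * (J x / p * m) = b0 + (J x % p + p * (J x / p)) * m by ring] at this
        have h3 : p ∣ x.2 := by exact_mod_cast this
        exact hpp.one_lt.ne' (Nat.dvd_one.1 (hx4 ▸ Nat.dvd_gcd h3 (hpg.mul_right m)))
    · intro x hx y hy hxy
      obtain ⟨e1, e2⟩ := hJ x hx
      obtain ⟨e3, e4⟩ := hJ y hy
      rw [hxy] at e1 e2
      have f1 : (x.1:ℤ) = y.1 := by rw [e1, e3]
      have f2 : (x.2:ℤ) = y.2 := by rw [e2, e4]
      exact Prod.ext (by exact_mod_cast f1) (by exact_mod_cast f2)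
  have hcrt := hcard.trans (aux_crt g.primeFactors (fun p hp => Nat.prime_of_mem_primeFactors hp)
    (3 * h) G (-(g:ℤ)))
  have hcrt' : (T.card : ℝ) ≤ 3 * h * ∏ p ∈ g.primeFactors, ((G p).card : ℝ) := by exact_mod_cast hcrt
  refine hcrt'.trans ?_
  have hbd : ∏ p ∈ g.primeFactors, ((G p).card : ℝ) ≤ ∏ p ∈ g.primeFactors,
      ((p:ℝ) * ((1 - 1 / (p:ℝ)) * (if (p:ℤ) ∣ n * m ∨ (p:ℤ) ∣ k then 1 else (1 - 1 / (p:ℝ))))) := by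
    apply Finset.prod_le_prod
    · intro p _; exact Nat.cast_nonneg _
    · intro p hp
      have := aux_G p (Nat.prime_of_mem_primeFactors hp) n m a0 b0 hcop
      rw [hk0] at this
      exact this
  have hw : ∏ p ∈ g.primeFactors, (if (p:ℤ) ∣ n * m ∨ (p:ℤ) ∣ k then 1 else (1 - 1 / (p:ℝ))) ≤
      (∏ p ∈ g.primeFactors \ (n * m).primeFactors, (1 - 1 / (p:ℝ))) *
        ((k.natAbs : ℝ) / k.natAbs.totient) := by
    have hkt : (k.natAbs : ℝ) / k.natAbs.totient = ∏ p ∈ k.natAbs.primeFactors, (1 - 1 / (p:ℝ))⁻¹ := by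
      rw [aux_totient, Finset.prod_inv_distrib]
      have : (k.natAbs:ℝ) ≠ 0 := by positivity
      rw [div_mul_eq_div_div, div_self this, one_div]
    rw [hkt]
    have s1 : ∏ p ∈ g.primeFactors, (if (p:ℤ) ∣ n * m ∨ (p:ℤ) ∣ k then 1 else (1 - 1 / (p:ℝ))) =
        ∏ p ∈ g.primeFactors \ (n * m).primeFactors, (if (p:ℤ) ∣ k then 1 else (1 - 1 / (p:ℝ))) := by
      symm
      have hmem : ∀ p ∈ g.primeFactors, (p ∈ (n * m).primeFactors ↔ (p:ℤ) ∣ n * m) := by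
        intro p hp
        rw [Nat.mem_primeFactors]
        have : ((p:ℤ) ∣ n * m) ↔ p ∣ n * m := by exact_mod_cast Int.natCast_dvd_natCast
        rw [this]
        have := Nat.mul_pos hn hm
        exact ⟨fun h => h.2.1, fun h => ⟨Nat.prime_of_mem_primeFactors hp, h, this.ne'⟩⟩
      have : ∏ p ∈ g.primeFactors \ (n * m).primeFactors, (if (p:ℤ) ∣ k then 1 else (1 - 1 / (p:ℝ)))
        = ∏ p ∈ g.primeFactors \ (n * m).primeFactors,
          (if (p:ℤ) ∣ n * m ∨ (p:ℤ) ∣ k then 1 else (1 - 1 / (p:ℝ))) := by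
        apply Finset.prod_congr rfl
        intro p hp
        rw [Finset.mem_sdiff] at hp
        have := (not_congr (hmem p hp.1)).1 hp.2
        simp only [this, false_or]
      rw [this]
      apply Finset.prod_subset Finset.sdiff_subset
      intro p hp hp2
      rw [Finset.mem_sdiff] at hp2
      have : p ∈ (n * m).primeFactors := by tauto
      rw [if_pos (Or.inl ((hmem p hp).1 this))]
    rw [s1]
    set U := g.primeFactors \ (n * m).primeFactors with hU
    have hUp : ∀ p ∈ U, p.Prime := fun p hp =>
      Nat.prime_of_mem_primeFactors (Finset.mem_sdiff.1 hp).1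
    have s2 : ∏ p ∈ U, (if (p:ℤ) ∣ k then 1 else (1 - 1 / (p:ℝ))) =
        (∏ p ∈ U, (1 - 1 / (p:ℝ))) * ∏ p ∈ U.filter (fun p : ℕ => (p:ℤ) ∣ k), (1 - 1 / (p:ℝ))⁻¹ := by
      rw [Finset.prod_filter, ← Finset.prod_mul_distrib]
      apply Finset.prod_congr rfl
      intro p hp
      have := aux_cpos p (hUp p hp)
      split_ifs
      · rw [mul_inv_cancel₀ this.ne']
      · simp
    rw [s2]
    apply mul_le_mul_of_nonneg_left _
      (Finset.prod_nonneg fun p hp => (aux_cpos p (hUp p hp)).le)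
    have hsub : U.filter (fun p : ℕ => (p:ℤ) ∣ k) ⊆ k.natAbs.primeFactors := by
      intro p hp
      rw [Finset.mem_filter] at hp
      rw [Nat.mem_primeFactors]
      exact ⟨hUp p hp.1, Int.natCast_dvd.1 hp.2, hkk.ne'⟩
    apply Finset.prod_le_prod_of_subset_of_one_le hsub
    · intro p hp
      exact inv_nonneg.2 (aux_cpos p (hUp p (Finset.mem_filter.1 hp).1)).le
    · intro p hp _
      have h1 := aux_cpos p (Nat.prime_of_mem_primeFactors hp)
      apply (one_le_inv₀ h1).2
      have : 0 ≤ 1 / (p:ℝ) := by positivity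
      linarith
  have hghR : (g:ℝ) = (∏ p ∈ g.primeFactors, (p:ℝ)) * h := by
    have h' := congrArg (Nat.cast : ℕ → ℝ) hh
    rwa [Nat.cast_mul, Nat.cast_prod] at h'
  have hc0 : 0 ≤ ∏ p ∈ g.primeFactors, (1 - 1 / (p:ℝ)) :=
    Finset.prod_nonneg fun p hp => (aux_cpos p (Nat.prime_of_mem_primeFactors hp)).le
  calc 3 * (h:ℝ) * ∏ p ∈ g.primeFactors, ((G p).card : ℝ) ≤ 3 * h * _ :=
        mul_le_mul_of_nonneg_left hbd (by positivity)
    _ = 3 * g * (∏ p ∈ g.primeFactors, (1 - 1 / (p:ℝ))) *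
        ∏ p ∈ g.primeFactors, (if (p:ℤ) ∣ n * m ∨ (p:ℤ) ∣ k then 1 else (1 - 1 / (p:ℝ))) := by
        rw [Finset.prod_mul_distrib, Finset.prod_mul_distrib, hghR]
        ring
    _ ≤ 3 * g * (∏ p ∈ g.primeFactors, (1 - 1 / (p:ℝ))) * _ :=
        mul_le_mul_of_nonneg_left hw (by positivity)
    _ = _ := by ring

lemma aux_DS_fin (ψ : ℕ → ℝ) (n : ℕ) : volume (DSset ψ n) ≠ ⊤ := by
  apply ne_top_of_le_ne_top _ (measure_mono (Set.inter_subset_right))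
  simp

lemma aux_lower (ψ : ℕ → ℝ) (hψ : ∀ n, ψ n ∈ Set.Icc (0:ℝ) (1/2)) (n : ℕ) (hn : 0 < n) :
    (n.totient : ℝ) * (ψ n / n) ≤ (volume (DSset ψ n)).toReal := by
  have hn' : (0:ℝ) < n := by exact_mod_cast hn
  obtain ⟨h0, h1⟩ := hψ n
  have hq : ψ n / n ≤ 1 / 2 / n := by gcongr
  have hq0 : 0 ≤ ψ n / n := by positivity
  set s := (Finset.range n).filter (Nat.Coprime n) with hs
  have hcard : s.card = n.totient := by rw [Nat.totient]
  have hsub : (⋃ a ∈ s, Set.Ioo ((a:ℝ) / n) ((a:ℝ) / n + ψ n / n)) ⊆ DSset ψ n := by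
    intro x hx
    simp only [Set.mem_iUnion] at hx
    obtain ⟨a, ha, hx1, hx2⟩ := hx
    rw [hs, Finset.mem_filter, Finset.mem_range] at ha
    refine ⟨?_, ?_⟩
    · simp only [Set.mem_iUnion]
      exact ⟨a, ⟨ha.1.le, ha.2.symm⟩, by linarith, by linarith⟩
    · have a1 : 0 ≤ (a:ℝ) / n := by positivity
      have a2 : (a:ℝ) / n + 1 / n ≤ 1 := by
        rw [← add_div, div_le_one hn']
        exact_mod_cast ha.1
      have a3 : 1 / 2 / (n:ℝ) ≤ 1 / n := by gcongr; norm_num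
      exact ⟨by linarith, by linarith⟩
  have hmeas : volume (⋃ a ∈ s, Set.Ioo ((a:ℝ) / n) ((a:ℝ) / n + ψ n / n)) =
      ENNReal.ofReal ((n.totient : ℝ) * (ψ n / n)) := by
    rw [measure_biUnion_finset]
    · simp only [Real.volume_Ioo, add_sub_cancel_left, Finset.sum_const, hcard]
      rw [nsmul_eq_mul, ENNReal.ofReal_mul (by positivity), ENNReal.ofReal_natCast]
    · intro a _ b _ hab
      have key : ∀ a b : ℕ, a < b → Disjoint (Set.Ioo ((a:ℝ) / n) ((a:ℝ) / n + ψ n / n))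
          (Set.Ioo ((b:ℝ) / n) ((b:ℝ) / n + ψ n / n)) := by
        intro a b hab
        rw [Set.disjoint_left]
        rintro x ⟨hx1, hx2⟩ ⟨hx3, hx4⟩
        have : (a:ℝ) / n + 1 / n ≤ b / n := by
          rw [← add_div]
          gcongr
          exact_mod_cast hab
        have a3 : 1 / 2 / (n:ℝ) ≤ 1 / n := by gcongr; norm_num
        linarith
      rcases lt_or_gt_of_ne hab with h | h
      · exact key a b h
      · exact (key b a h).symm
    · intro a _
      exact measurableSet_Ioo
  rw [← ENNReal.ofReal_le_iff_le_toReal (aux_DS_fin ψ n), ← hmeas]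
  exact measure_mono hsub

noncomputable def auxE (ψ : ℕ → ℝ) (n m : ℕ) : Finset (ℕ × ℕ) := by
  classical
  exact ((Finset.range (n + 1)) ×ˢ (Finset.range (m + 1))).filter (fun x =>
    Nat.Coprime x.1 n ∧ Nat.Coprime x.2 m ∧ |(x.1:ℝ) / n - x.2 / m| ≤ ψ n / n + ψ m / m)

lemma aux_upper (ψ : ℕ → ℝ) (hψ : ∀ n, ψ n ∈ Set.Icc (0:ℝ) (1/2)) (n m : ℕ) :
    (volume (DSset ψ n ∩ DSset ψ m)).toReal ≤
      (auxE ψ n m).card * (2 * min (ψ n / n) (ψ m / m)) := by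
  have hn0 : 0 ≤ ψ n / n := div_nonneg (hψ n).1 (by positivity)
  have hm0 : 0 ≤ ψ m / m := div_nonneg (hψ m).1 (by positivity)
  have hmin : 0 ≤ min (ψ n / n) (ψ m / m) := le_min hn0 hm0
  have hsub : DSset ψ n ∩ DSset ψ m ⊆ ⋃ x ∈ auxE ψ n m,
      (Set.Icc ((x.1 : ℝ) / n - ψ n / n) ((x.1 : ℝ) / n + ψ n / n) ∩
       Set.Icc ((x.2 : ℝ) / m - ψ m / m) ((x.2 : ℝ) / m + ψ m / m)) := by
    rintro x ⟨⟨h1, -⟩, ⟨h2, -⟩⟩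
    simp only [Set.mem_iUnion] at h1 h2 ⊢
    obtain ⟨a, ⟨ha1, ha2⟩, ha3⟩ := h1
    obtain ⟨b, ⟨hb1, hb2⟩, hb3⟩ := h2
    refine ⟨(a, b), ?_, ha3, hb3⟩
    simp only [auxE, Finset.mem_filter, Finset.mem_product, Finset.mem_range]
    refine ⟨⟨by omega, by omega⟩, ha2, hb2, ?_⟩
    rw [abs_le]
    exact ⟨by linarith [ha3.1, ha3.2, hb3.1, hb3.2], by linarith [ha3.1, ha3.2, hb3.1, hb3.2]⟩
  apply ENNReal.toReal_le_of_le_ofReal (by positivity)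
  calc _ ≤ _ := measure_mono hsub
    _ ≤ ∑ x ∈ auxE ψ n m, volume
      (Set.Icc ((x.1 : ℝ) / n - ψ n / n) ((x.1 : ℝ) / n + ψ n / n) ∩
       Set.Icc ((x.2 : ℝ) / m - ψ m / m) ((x.2 : ℝ) / m + ψ m / m)) := measure_biUnion_finset_le _ _
    _ ≤ ∑ x ∈ auxE ψ n m, ENNReal.ofReal (2 * min (ψ n / n) (ψ m / m)) := by
      apply Finset.sum_le_sum
      intro x _
      rcases min_choice (ψ n / n) (ψ m / m) with h | h
      · rw [h]
        refine (measure_mono Set.inter_subset_left).trans (le_of_eq ?_)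
        rw [Real.volume_Icc]; congr 1; ring
      · rw [h]
        refine (measure_mono Set.inter_subset_right).trans (le_of_eq ?_)
        rw [Real.volume_Icc]; congr 1; ring
    _ = _ := by
      rw [Finset.sum_const, nsmul_eq_mul, ENNReal.ofReal_mul (p := ((auxE ψ n m).card : ℝ)) (by positivity), ENNReal.ofReal_natCast]

lemma aux_E_prop (ψ : ℕ → ℝ) (g n' m' n m : ℕ) (hg : 0 < g) (hn' : 0 < n')
    (hm' : 0 < m') (hcop : Nat.Coprime n' m') (hn : n = g * n') (hm : m = g * m') (hne : n ≠ m)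
    (hgcd : Nat.gcd n m = g) (x : ℕ × ℕ) (hx : x ∈ auxE ψ n m) :
    ((x.1:ℤ) * m' - x.2 * n').natAbs ∈ (Finset.Icc 1 ⌊2 * Dfun ψ n m⌋₊).filter
      (fun k => Nat.Coprime k (n' * m')) := by
  simp only [auxE, Finset.mem_filter, Finset.mem_product, Finset.mem_range] at hx
  obtain ⟨⟨h1, h2⟩, h3, h4, h5⟩ := hx
  have hgR : (0:ℝ) < g := by exact_mod_cast hg
  have hn'R : (0:ℝ) < n' := by exact_mod_cast hn'
  have hm'R : (0:ℝ) < m' := by exact_mod_cast hm'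
  have hnR : (n:ℝ) = g * n' := by rw [hn]; push_cast; rfl
  have hmR : (m:ℝ) = g * m' := by rw [hm]; push_cast; rfl
  have hk0 : (x.1:ℤ) * m' - x.2 * n' ≠ 0 := by
    intro h
    have e1 : x.1 * m' = x.2 * n' := by
      have : (x.1:ℤ) * m' = x.2 * n' := by linarith
      exact_mod_cast this
    have e2 : x.1 * m = x.2 * n := by rw [hn, hm]; linear_combination g * e1
    apply hne
    apply Nat.dvd_antisymm
    · exact h3.symm.dvd_of_dvd_mul_left (e2 ▸ dvd_mul_left n x.2)
    · exact h4.symm.dvd_of_dvd_mul_left (e2.symm ▸ dvd_mul_left m x.1)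
  rw [Finset.mem_filter, Finset.mem_Icc]
  refine ⟨⟨Int.natAbs_pos.2 hk0, ?_⟩, ?_⟩
  · apply Nat.le_floor
    have e : (((x.1:ℤ) * m' - x.2 * n').natAbs : ℝ) = |(x.1:ℝ) * m' - x.2 * n'| := by
      rw [Nat.cast_natAbs]; push_cast; rfl
    rw [e, Dfun, hgcd]
    have e3 : (x.1:ℝ) * m' - x.2 * n' = ((x.1:ℝ) / n - x.2 / m) * (n * m / g) := by
      rw [hnR, hmR]; field_simp
    have hpos : 0 ≤ (n:ℝ) * m / g := by positivity
    rw [e3, abs_mul, abs_of_nonneg hpos]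
    calc _ ≤ (ψ n / n + ψ m / m) * (n * m / g) := mul_le_mul_of_nonneg_right h5 hpos
      _ = (m * ψ n + n * ψ m) / g := by rw [hnR, hmR]; field_simp
      _ ≤ (2 * max (m * ψ n) (n * ψ m)) / g := by
        gcongr
        linarith [le_max_left ((m:ℝ) * ψ n) (n * ψ m), le_max_right ((m:ℝ) * ψ n) (n * ψ m)]
      _ = _ := by ring
  · have c0 : IsCoprime (n':ℤ) m' := Nat.isCoprime_iff_coprime.2 hcop
    have c1 : IsCoprime (n':ℤ) x.1 := Nat.isCoprime_iff_coprime.2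
      (Nat.Coprime.coprime_dvd_left (hn ▸ dvd_mul_left n' g) h3.symm)
    have c2 : IsCoprime (m':ℤ) x.2 := Nat.isCoprime_iff_coprime.2
      (Nat.Coprime.coprime_dvd_left (hm ▸ dvd_mul_left m' g) h4.symm)
    have d1 : IsCoprime (n':ℤ) ((x.1:ℤ) * m' - x.2 * n') := by
      have := (c1.mul_right c0).add_mul_left_right (-x.2)
      rwa [show (x.1:ℤ) * m' + n' * (-x.2) = x.1 * m' - x.2 * n' by ring] at this
    have d2 : IsCoprime (m':ℤ) ((x.1:ℤ) * m' - x.2 * n') := by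
      have := ((c2.mul_right c0.symm).neg_right).add_mul_left_right (x.1)
      rwa [show -((x.2:ℤ) * n') + m' * x.1 = x.1 * m' - x.2 * n' by ring] at this
    have d3 := d1.mul_left d2
    rw [Int.isCoprime_iff_gcd_eq_one] at d3
    rw [Nat.coprime_comm]
    unfold Nat.Coprime
    rw [Int.gcd, Int.natAbs_mul, Int.natAbs_natCast, Int.natAbs_natCast] at d3
    exact d3

lemma aux_E_card (ψ : ℕ → ℝ) (g n' m' n m : ℕ) (hg : 0 < g) (hn' : 0 < n')
    (hm' : 0 < m') (hcop : Nat.Coprime n' m') (hn : n = g * n') (hm : m = g * m') (hne : n ≠ m)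
    (hgcd : Nat.gcd n m = g) :
    ((auxE ψ n m).card : ℝ) ≤ 6 * g * ((∏ p ∈ g.primeFactors, (1 - 1 / (p:ℝ))) *
      ∏ p ∈ g.primeFactors \ (n' * m').primeFactors, (1 - 1 / (p:ℝ))) *
      ∑ k ∈ (Finset.Icc 1 ⌊2 * Dfun ψ n m⌋₊).filter
      (fun k => Nat.Coprime k (n' * m')), (k:ℝ) / k.totient := by
  rw [Finset.card_eq_sum_card_fiberwise (f := fun x : ℕ × ℕ => ((x.1:ℤ) * m' - x.2 * n').natAbs)
    (fun x hx => aux_E_prop ψ g n' m' n m hg hn' hm' hcop hn hm hne hgcd x hx)]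
  push_cast
  rw [Finset.mul_sum]
  apply Finset.sum_le_sum
  intro l hl
  have hl1 : 1 ≤ l := (Finset.mem_Icc.1 (Finset.mem_filter.1 hl).1).1
  have key : ∀ k : ℤ, k.natAbs = l →
      (((auxE ψ n m).filter (fun x : ℕ × ℕ => (x.1:ℤ) * m' - x.2 * n' = k)).card : ℝ) ≤
      3 * g * ((∏ p ∈ g.primeFactors, (1 - 1 / (p:ℝ))) *
      ∏ p ∈ g.primeFactors \ (n' * m').primeFactors, (1 - 1 / (p:ℝ))) * ((l:ℝ) / l.totient) := by
    intro k hk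
    rw [← hk]
    apply aux_Nk g n' m' hg hn' hm' hcop k (by intro h; subst h; simp at hk; omega)
    intro x hx
    rw [Finset.mem_filter] at hx
    obtain ⟨hx, hx2⟩ := hx
    simp only [auxE, Finset.mem_filter, Finset.mem_product, Finset.mem_range] at hx
    obtain ⟨⟨h1, h2⟩, h3, h4, h5⟩ := hx
    rw [← hn, ← hm]
    exact ⟨by omega, by omega, h3, h4, hx2⟩
  have hsub : (auxE ψ n m).filter (fun x : ℕ × ℕ => ((x.1:ℤ) * m' - x.2 * n').natAbs = l) ⊆
      (auxE ψ n m).filter (fun x : ℕ × ℕ => (x.1:ℤ) * m' - x.2 * n' = (l:ℤ)) ∪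
      (auxE ψ n m).filter (fun x : ℕ × ℕ => (x.1:ℤ) * m' - x.2 * n' = -(l:ℤ)) := by
    intro x hx
    rw [Finset.mem_filter] at hx
    rw [Finset.mem_union, Finset.mem_filter, Finset.mem_filter]
    rcases Int.natAbs_eq ((x.1:ℤ) * m' - x.2 * n') with h | h
    · left; exact ⟨hx.1, by rw [h, hx.2]⟩
    · right; exact ⟨hx.1, by rw [h, hx.2]⟩
  have h1 := (Finset.card_le_card hsub).trans (Finset.card_union_le _ _)
  have h2 : (((auxE ψ n m).filter (fun x : ℕ × ℕ => ((x.1:ℤ) * m' - x.2 * n').natAbs = l)).card : ℝ) ≤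
      ((auxE ψ n m).filter (fun x : ℕ × ℕ => (x.1:ℤ) * m' - x.2 * n' = (l:ℤ))).card +
      ((auxE ψ n m).filter (fun x : ℕ × ℕ => (x.1:ℤ) * m' - x.2 * n' = -(l:ℤ))).card := by
    exact_mod_cast h1
  have h3 := key l (by simp)
  have h4 := key (-l) (by simp)
  linarith

lemma aux_pf (g n' m' : ℕ) (hg : 0 < g) (hn' : 0 < n') (hm' : 0 < m')
    (hgcd : Nat.gcd (g * n') (g * m') = g) (c : ℕ → ℝ) :
    (∏ p ∈ g.primeFactors, c p) * (∏ p ∈ g.primeFactors \ (n' * m').primeFactors, c p) *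
      (∏ p ∈ (n' * m').primeFactors, c p) =
    (∏ p ∈ (g * n').primeFactors, c p) * ∏ p ∈ (g * m').primeFactors, c p := by
  rw [← Finset.prod_union_inter (s₁ := (g * n').primeFactors), ← Nat.primeFactors_gcd
    (Nat.mul_pos hg hn').ne' (Nat.mul_pos hg hm').ne', hgcd, mul_assoc,
    ← Finset.prod_union Finset.sdiff_disjoint, mul_comm]
  congr 1
  apply Finset.prod_congr _ fun _ _ => rfl
  rw [Nat.primeFactors_mul hg.ne' hn'.ne', Nat.primeFactors_mul hg.ne' hm'.ne',
    Nat.primeFactors_mul hn'.ne' hm'.ne', Finset.sdiff_union_self_eq_union]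
  ext p
  simp only [Finset.mem_union]
  tauto

lemma aux_P3 (Q : ℕ) (hQ : 0 < Q) (D : ℝ) (hD : 0 ≤ D) :
    ∏ p ∈ (Finset.Icc 1 ⌊2 * D⌋₊).filter (fun p => p.Prime ∧ p ∣ Q), (1 - 1 / (p:ℝ)) ≤
    Real.exp 1 * ((∏ p ∈ Q.primeFactors, (1 - 1 / (p:ℝ))) *
      ∏ p ∈ Q.primeFactors, Set.mulIndicator {q : ℕ | D < (q : ℝ)}
              (fun q => 1 + 1 / (q : ℝ)) p) := by
  classical
  have hpr : ∀ p ∈ Q.primeFactors, p.Prime := fun p hp => Nat.prime_of_mem_primeFactors hp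
  have h1 : ∏ p ∈ (Finset.Icc 1 ⌊2 * D⌋₊).filter (fun p => p.Prime ∧ p ∣ Q), (1 - 1 / (p:ℝ)) ≤
      ∏ p ∈ Q.primeFactors, (if D < (p:ℝ) then 1 else (1 - 1 / (p:ℝ))) := by
    have : ∏ p ∈ Q.primeFactors, (if D < (p:ℝ) then 1 else (1 - 1 / (p:ℝ))) =
      ∏ p ∈ Q.primeFactors.filter (fun p : ℕ => ¬ D < (p:ℝ)), (1 - 1 / (p:ℝ)) := by
      rw [Finset.prod_filter]
      apply Finset.prod_congr rfl
      intro p _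
      by_cases h : D < (p:ℝ) <;> simp [h]
    rw [this]
    have hsub : Q.primeFactors.filter (fun p : ℕ => ¬ D < (p:ℝ)) ⊆
        (Finset.Icc 1 ⌊2 * D⌋₊).filter (fun p => p.Prime ∧ p ∣ Q) := by
      intro p hp
      rw [Finset.mem_filter] at hp
      obtain ⟨hp, hpD⟩ := hp
      rw [Finset.mem_filter, Finset.mem_Icc]
      refine ⟨⟨(hpr p hp).one_le, Nat.le_floor ?_⟩, hpr p hp, Nat.dvd_of_mem_primeFactors hp⟩
      linarith
    rw [← Finset.prod_sdiff hsub]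
    apply mul_le_of_le_one_left
    · apply Finset.prod_nonneg
      intro p hp
      exact (aux_cpos p (hpr p (Finset.mem_filter.1 hp).1)).le
    · apply Finset.prod_le_one
      · intro p hp
        exact (aux_cpos p (Finset.mem_filter.1 (Finset.mem_sdiff.1 hp).1).2.1).le
      · intro p _
        have : 0 ≤ 1 / (p:ℝ) := by positivity
        linarith
  refine h1.trans ?_
  calc _ ≤ ∏ p ∈ Q.primeFactors, (Real.exp (1 / ((p:ℝ) * (p - 1))) * ((1 - 1 / (p:ℝ)) *
          Set.mulIndicator {q : ℕ | D < (q : ℝ)} (fun q => 1 + 1 / (q : ℝ)) p)) := by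
        apply Finset.prod_le_prod
        · intro p hp
          split_ifs
          · norm_num
          · exact (aux_cpos p (hpr p hp)).le
        · intro p hp
          have hp2 : (2:ℝ) ≤ p := by exact_mod_cast (hpr p hp).two_le
          have hc := aux_cpos p (hpr p hp)
          have hx : 0 ≤ 1 / ((p:ℝ) * (p - 1)) := by
            apply div_nonneg zero_le_one
            apply mul_nonneg <;> linarith
          have he := Real.add_one_le_exp (1 / ((p:ℝ) * (p - 1)))
          rw [Set.mulIndicator_apply]
          simp only [Set.mem_setOf_eq]
          split_ifs
          · have hp1 : (0:ℝ) < p - 1 := by linarith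
            have e1 : (1:ℝ) ≤ (1 / ((p:ℝ) * (p - 1)) + 1) * ((1 - 1 / (p:ℝ)) * (1 + 1 / p)) := by
              have : (1 / ((p:ℝ) * (p - 1)) + 1) * ((1 - 1 / (p:ℝ)) * (1 + 1 / p)) = 1 + 1 / p ^ 3 := by
                field_simp
                ring
              rw [this]
              have : 0 ≤ 1 / (p:ℝ) ^ 3 := by positivity
              linarith
            refine e1.trans (mul_le_mul_of_nonneg_right he ?_)
            positivity
          · rw [mul_one]
            exact le_mul_of_one_le_left hc.le (by linarith)
    _ = Real.exp (∑ p ∈ Q.primeFactors, 1 / ((p:ℝ) * (p - 1))) * _ := by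
        rw [Finset.prod_mul_distrib, Finset.prod_mul_distrib, Real.exp_sum]
    _ ≤ _ := by
        apply mul_le_mul_of_nonneg_right
        · apply Real.exp_le_exp.2
          exact aux_tele_le _ fun p hp => (hpr p hp).one_le
        · apply mul_nonneg
          · exact Finset.prod_nonneg fun p hp => (aux_cpos p (hpr p hp)).le
          · apply Finset.prod_nonneg
            intro p _
            rw [Set.mulIndicator_apply]
            split_ifs <;> positivity

theorem overlap_estimate_crude :
    ∃ K : ℝ, 0 < K ∧ ∀ (ψ : ℕ → ℝ), (∀ n, ψ n ∈ Set.Icc (0:ℝ) (1/2)) →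
      ∀ (n m : ℕ), 0 < n → 0 < m → n ≠ m →
      (volume (DSset ψ n ∩ DSset ψ m)).toReal ≤
        K * ((volume (DSset ψ n)).toReal * (volume (DSset ψ m)).toReal *
          ∏ p ∈ (n * m / Nat.gcd n m ^ 2).primeFactors,
            Set.mulIndicator {q : ℕ | Dfun ψ n m < (q : ℝ)}
              (fun q => 1 + 1 / (q : ℝ)) p) := by
  obtain ⟨C, hC, hsieve⟩ := aux_sieve
  refine ⟨24 * C * Real.exp 1, by positivity, ?_⟩
  intro ψ hψ n m hn0 hm0 hne
  obtain ⟨n', m', hcop, hn, hm⟩ := Nat.exists_coprime n m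
  set g := Nat.gcd n m with hgdef
  have hg : 0 < g := Nat.gcd_pos_of_pos_left _ hn0
  have hn' : 0 < n' := Nat.pos_of_ne_zero (by rintro rfl; omega)
  have hm' : 0 < m' := Nat.pos_of_ne_zero (by rintro rfl; omega)
  rw [mul_comm] at hn hm
  have hQ : n * m / g ^ 2 = n' * m' := by
    have : n * m = g ^ 2 * (n' * m') := by
      calc n * m = (g * n') * (g * m') := by rw [← hn, ← hm]
        _ = _ := by ring
    rw [this, Nat.mul_div_cancel_left _ (by positivity)]
  rw [hQ]
  have hnR : (0:ℝ) < n := by exact_mod_cast hn0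
  have hmR : (0:ℝ) < m := by exact_mod_cast hm0
  have hgR : (0:ℝ) < g := by exact_mod_cast hg
  have hψn := (hψ n).1
  have hψm := (hψ m).1
  set D := Dfun ψ n m with hD
  have hD0 : 0 ≤ D := by
    rw [hD, Dfun]
    apply div_nonneg _ (by positivity)
    exact le_max_of_le_left (by positivity)
  set I := ∏ p ∈ (n' * m').primeFactors,
            Set.mulIndicator {q : ℕ | D < (q : ℝ)} (fun q => 1 + 1 / (q : ℝ)) p with hI
  have hI0 : 0 ≤ I := by
    apply Finset.prod_nonneg
    intro p _
    rw [Set.mulIndicator_apply]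
    split_ifs <;> positivity
  have hup := aux_upper ψ hψ n m
  have hcard := aux_E_card ψ g n' m' n m hg hn' hm' hcop hn hm hne rfl
  set δ := min (ψ n / n) (ψ m / m) with hδ
  have hδ0 : 0 ≤ δ := le_min (by positivity) (by positivity)
  have hδD : δ * g * D = ψ n * ψ m := by
    have e1 : D = (n * m) * max (ψ n / n) (ψ m / m) / g := by
      rw [hD, Dfun, mul_max_of_nonneg _ _ (by positivity)]
      congr 2 <;> field_simp
    have e2 : δ * max (ψ n / n) (ψ m / m) = ψ n / n * (ψ m / m) := by
      rw [hδ, min_mul_max]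
    rw [e1]
    calc _ = (n * m) * (δ * max (ψ n / n) (ψ m / m)) := by field_simp
      _ = _ := by rw [e2]; field_simp
  set P1 := ∏ p ∈ g.primeFactors, (1 - 1 / (p:ℝ)) with hP1
  set P2 := ∏ p ∈ g.primeFactors \ (n' * m').primeFactors, (1 - 1 / (p:ℝ)) with hP2
  set PH := ∏ p ∈ (n' * m').primeFactors, (1 - 1 / (p:ℝ)) with hPH
  have hP10 : 0 ≤ P1 :=
    Finset.prod_nonneg fun p hp => (aux_cpos p (Nat.prime_of_mem_primeFactors hp)).le
  have hP20 : 0 ≤ P2 := Finset.prod_nonneg fun p hp =>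
    (aux_cpos p (Nat.prime_of_mem_primeFactors (Finset.mem_sdiff.1 hp).1)).le
  have hPH0 : 0 ≤ PH :=
    Finset.prod_nonneg fun p hp => (aux_cpos p (Nat.prime_of_mem_primeFactors hp)).le
  have hS : ∑ k ∈ (Finset.Icc 1 ⌊2 * D⌋₊).filter
      (fun k => Nat.Coprime k (n' * m')), (k:ℝ) / k.totient ≤
      C * (2 * D) * (Real.exp 1 * (PH * I)) := by
    rcases Nat.eq_zero_or_pos ⌊2 * D⌋₊ with h0 | h0
    · rw [h0]; simp; positivity
    · refine (hsieve (n' * m') _ h0).trans ?_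
      have a1 := aux_P3 (n' * m') (Nat.mul_pos hn' hm') D hD0
      have a2 : (⌊2 * D⌋₊ : ℝ) ≤ 2 * D := Nat.floor_le (by positivity)
      calc _ ≤ C * (⌊2 * D⌋₊ : ℝ) * (Real.exp 1 * (PH * I)) :=
            mul_le_mul_of_nonneg_left a1 (by positivity)
        _ ≤ _ := by gcongr
  have hpf := aux_pf g n' m' hg hn' hm' (by rw [← hn, ← hm]) (fun p => 1 - 1 / (p:ℝ))
  rw [← hn, ← hm] at hpf
  have hlow1 := aux_lower ψ hψ n hn0
  have hlow2 := aux_lower ψ hψ m hm0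
  have hA0 : 0 ≤ (n.totient : ℝ) * (ψ n / n) := by positivity
  have hB0 : 0 ≤ (m.totient : ℝ) * (ψ m / m) := by positivity
  have hprod : (n.totient : ℝ) * (ψ n / n) * ((m.totient : ℝ) * (ψ m / m)) =
      ψ n * ψ m * (P1 * P2 * PH) := by
    rw [hpf, aux_totient n, aux_totient m]
    field_simp
  calc _ ≤ _ := hup
    _ ≤ (6 * g * (P1 * P2) * (C * (2 * D) * (Real.exp 1 * (PH * I)))) * (2 * δ) := by
        apply mul_le_mul_of_nonneg_right _ (by positivity)
        refine hcard.trans (mul_le_mul_of_nonneg_left hS (by positivity))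
    _ = 24 * C * Real.exp 1 * ((δ * g * D) * (P1 * P2 * PH) * I) := by ring
    _ = 24 * C * Real.exp 1 * ((n.totient : ℝ) * (ψ n / n) * ((m.totient : ℝ) * (ψ m / m)) * I) := by
        rw [hδD, hprod]
    _ ≤ _ := by gcongr
end
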